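/- arXiv:2206.04175 — 2 statements merged into one kernel-verified Lean document; each statement's English description precedes it below -/
import Mathlib

section
/- Let P ⊂ ℝ^d be a full-dimensional rational polytope with denominator q. Then the boundary h*-polynomial h*_{∂P}(z) is a polynomial with integer coefficients of degree exactly qd, and it is palindromic: z^{qd}·h*_{∂P}(1/z) = h*_{∂P}(z). -/
open Pointwise

/-- `x ∈ ℤ^d`, i.e. every coordinate of `x` is an integer. -/
def IsLatticePt {d : ℕ} (x : Fin d → ℝ) : Prop := ∀ i, ∃ a : ℤ, x i = (a : ℝ)

/-- `x ∈ ℚ^d`, i.e. every coordinate of `x` is rational. -/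
def IsRationalPt {d : ℕ} (x : Fin d → ℝ) : Prop := ∀ i, ∃ a : ℚ, x i = (a : ℝ)

/-- `P` is a lattice polytope: the convex hull of finitely many points of `ℤ^d`. -/
def IsLatticePolytope {d : ℕ} (P : Set (Fin d → ℝ)) : Prop :=
  ∃ V : Finset (Fin d → ℝ), (∀ v ∈ V, IsLatticePt v) ∧ P = convexHull ℝ (V : Set (Fin d → ℝ))

/-- `P` is a rational polytope: the convex hull of finitely many points of `ℚ^d`. -/
def IsRationalPolytope {d : ℕ} (P : Set (Fin d → ℝ)) : Prop :=
  ∃ V : Finset (Fin d → ℝ), (∀ v ∈ V, IsRationalPt v) ∧ P = convexHull ℝ (V : Set (Fin d → ℝ))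

/-- A convex subset of `ℝ^d` is full-dimensional iff its interior is nonempty. -/
def IsFullDim {d : ℕ} (P : Set (Fin d → ℝ)) : Prop := (interior P).Nonempty

/-- The number of lattice points in `S`. -/
noncomputable def latCount {d : ℕ} (S : Set (Fin d → ℝ)) : ℕ :=
  Set.ncard {x ∈ S | IsLatticePt x}

/-- The Ehrhart series `Ehr_P(z) = 1 + ∑_{n ≥ 1} #(nP ∩ ℤ^d) zⁿ`. -/
noncomputable def ehrSeries {d : ℕ} (P : Set (Fin d → ℝ)) : PowerSeries ℤ :=
  PowerSeries.mk fun n => if n = 0 then 1 else (latCount ((n : ℝ) • P) : ℤ)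

/-- The interior Ehrhart series `∑_{n ≥ 1} #(nP° ∩ ℤ^d) zⁿ`. -/
noncomputable def ehrIntSeries {d : ℕ} (P : Set (Fin d → ℝ)) : PowerSeries ℤ :=
  PowerSeries.mk fun n => if n = 0 then 0 else (latCount (interior ((n : ℝ) • P)) : ℤ)

/-- The boundary Ehrhart series `1 + ∑_{n ≥ 1} #(n ∂P ∩ ℤ^d) zⁿ`. -/
noncomputable def ehrBdSeries {d : ℕ} (P : Set (Fin d → ℝ)) : PowerSeries ℤ :=
  PowerSeries.mk fun n => if n = 0 then 1 else (latCount (frontier ((n : ℝ) • P)) : ℤ)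

/-- `q` is the denominator of `P`: the smallest positive integer such that `qP` is a
lattice polytope. -/
def IsDenominator {d : ℕ} (P : Set (Fin d → ℝ)) (q : ℕ) : Prop :=
  0 < q ∧ IsLatticePolytope ((q : ℝ) • P) ∧
    ∀ k : ℕ, 0 < k → IsLatticePolytope ((k : ℝ) • P) → q ≤ k

/-- `l` is the smallest positive integer such that the interior of `lP` contains a
lattice point. -/
def IsMinInteriorDilate {d : ℕ} (P : Set (Fin d → ℝ)) (l : ℕ) : Prop :=
  0 < l ∧ (∃ x, IsLatticePt x ∧ x ∈ interior ((l : ℝ) • P)) ∧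
    ∀ k : ℕ, 0 < k → (∃ x, IsLatticePt x ∧ x ∈ interior ((k : ℝ) • P)) → l ≤ k

/-- The homogenization of the half-open simplex with vertices `w 0, …, w (k-1)`
where the facets opposite the first `r` vertices are removed:
`hom(Δ) = Σ_{j<r} ℝ_{>0} (w j, 1) + Σ_{j≥r} ℝ_{≥0} (w j, 1) ⊆ ℝ^{d+1}`. -/
def homog {d k : ℕ} (w : Fin k → (Fin d → ℝ)) (r : ℕ) : Set (Fin (d + 1) → ℝ) :=
  {y | ∃ c : Fin k → ℝ, (∀ j : Fin k, (j : ℕ) < r → 0 < c j) ∧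
    (∀ j : Fin k, r ≤ (j : ℕ) → 0 ≤ c j) ∧
    y = ∑ j : Fin k, c j • (Fin.snoc (w j) 1 : Fin (d + 1) → ℝ)}

/-- The fundamental parallelepiped
`F'_Δ = Σ_{j<r} (0,1] (q_j w_j, q_j) + Σ_{j≥r} [0,1) (q_j w_j, q_j) ⊆ ℝ^{d+1}`. -/
def fpar {d k : ℕ} (w : Fin k → (Fin d → ℝ)) (r : ℕ) (q : Fin k → ℕ) :
    Set (Fin (d + 1) → ℝ) :=
  {y | ∃ c : Fin k → ℝ, (∀ j : Fin k, (j : ℕ) < r → c j ∈ Set.Ioc (0 : ℝ) 1) ∧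
    (∀ j : Fin k, r ≤ (j : ℕ) → c j ∈ Set.Ico (0 : ℝ) 1) ∧
    y = ∑ j : Fin k, c j • ((q j : ℝ) • (Fin.snoc (w j) 1 : Fin (d + 1) → ℝ))}

/-- The generating function `∑_{x ∈ S ∩ ℤ^{d+1}} z^{x_{d+1}}` of a subset `S ⊆ ℝ^{d+1}`,
graded by the last coordinate. -/
noncomputable def sliceSeries {d : ℕ} (S : Set (Fin (d + 1) → ℝ)) : PowerSeries ℤ :=
  PowerSeries.mk fun n =>
    (Set.ncard {y ∈ S | IsLatticePt y ∧ y (Fin.last d) = (n : ℝ)} : ℤ)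

/-- A polynomial is palindromic if `z^{deg f} f(1/z) = f(z)`,
i.e. `f_i = f_{deg f − i}` for all `i ≤ deg f`. -/
def IsPalin (f : Polynomial ℤ) : Prop :=
  ∀ i ≤ f.natDegree, f.coeff i = f.coeff (f.natDegree - i)

/-- `P` is rational reflexive: the origin is an interior point and `P = {x : A x ≤ 𝟙}`
for some integer matrix `A`. -/
def IsRationalReflexive {d : ℕ} (P : Set (Fin d → ℝ)) : Prop :=
  IsRationalPolytope P ∧ (0 : Fin d → ℝ) ∈ interior P ∧
    ∃ (m : ℕ) (A : Fin m → Fin d → ℤ),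
      P = {x : Fin d → ℝ | ∀ j, (∑ i, (A j i : ℝ) * x i) ≤ 1}

/-- `P` is a reflexive (lattice) polytope. -/
def IsReflexive {d : ℕ} (P : Set (Fin d → ℝ)) : Prop :=
  IsLatticePolytope P ∧ (0 : Fin d → ℝ) ∈ interior P ∧
    ∃ (m : ℕ) (A : Fin m → Fin d → ℤ),
      P = {x : Fin d → ℝ | ∀ j, (∑ i, (A j i : ℝ) * x i) ≤ 1}

/-- `P` is an integral translate of a reflexive polytope. -/
def IsTranslatedReflexive {d : ℕ} (P : Set (Fin d → ℝ)) : Prop :=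
  ∃ (Q : Set (Fin d → ℝ)) (t : Fin d → ℤ), IsReflexive Q ∧
    P = (fun y => y + fun i => (t i : ℝ)) '' Q

/-- The rational Ehrhart series `1 + ∑_{n ≥ 1} #((n/r) P ∩ ℤ^d) wⁿ`. -/
noncomputable def ratEhrSeries {d : ℕ} (P : Set (Fin d → ℝ)) (r : ℕ) : PowerSeries ℤ :=
  PowerSeries.mk fun n => if n = 0 then 1 else (latCount (((n : ℝ) / (r : ℝ)) • P) : ℤ)

/-- The rational boundary Ehrhart series `1 + ∑_{n ≥ 1} #((n/r) ∂P ∩ ℤ^d) wⁿ`. -/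
noncomputable def ratEhrBdSeries {d : ℕ} (P : Set (Fin d → ℝ)) (r : ℕ) : PowerSeries ℤ :=
  PowerSeries.mk fun n =>
    if n = 0 then 1 else (latCount (frontier (((n : ℝ) / (r : ℝ)) • P)) : ℤ)

/-- `r` is the codenominator of `P`: given an irredundant halfspace description
`P = {x : A x ≤ b}` with integer data and `gcd(b_j, A_{j,1}, …, A_{j,d}) = 1` for each `j`,
`r` is the least common multiple of the nonzero entries of `b`. -/
def IsCodenominator {d : ℕ} (P : Set (Fin d → ℝ)) (r : ℕ) : Prop :=
  ∃ (m : ℕ) (A : Fin m → Fin d → ℤ) (b : Fin m → ℤ),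
    P = {x : Fin d → ℝ | ∀ j, (∑ i, (A j i : ℝ) * x i) ≤ (b j : ℝ)} ∧
    (∀ j₀ : Fin m,
      P ≠ {x : Fin d → ℝ | ∀ j, j ≠ j₀ → (∑ i, (A j i : ℝ) * x i) ≤ (b j : ℝ)}) ∧
    (∀ j, Int.gcd (b j) (Finset.univ.gcd fun i => A j i) = 1) ∧
    (r : ℤ) = (Finset.univ.filter fun j => b j ≠ 0).lcm b

abbrev EE (d : ℕ) := (Fin d → ℝ) × ℝ

def lexpos {m : ℕ} (a : Fin m → ℝ) : Prop := ∃ i, 0 < a i ∧ ∀ j < i, a j = 0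

def inCone {d m : ℕ} (w : Fin m → EE d) (y : EE d) : Prop :=
  ∃ c : Fin m → ℝ, (∀ j, 0 ≤ c j) ∧ ∑ j, c j • w j = y

def IsMn {d m : ℕ} (w : Fin m → EE d) (c : Fin m → ℝ) : Prop :=
  (∀ j, 0 ≤ c j) ∧ ∀ a : Fin m → ℝ, (∀ j, a j ≤ c j) → ∑ j, a j • w j = 0 → ¬ lexpos a

lemma lexpos_or {m : ℕ} (a : Fin m → ℝ) (ha : a ≠ 0) : lexpos a ∨ lexpos (-a) := by
  classical
  have hne : (Finset.univ.filter fun i => a i ≠ 0).Nonempty := by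
    by_contra h
    apply ha
    ext i
    by_contra hi
    exact h ⟨i, by simpa using hi⟩
  set i := Finset.min' _ hne with hi
  have h1 : a i ≠ 0 := by
    have := Finset.min'_mem _ hne
    simpa using this
  have h2 : ∀ j < i, a j = 0 := by
    intro j hj
    by_contra h
    have := Finset.min'_le (Finset.univ.filter fun i => a i ≠ 0) j (by simpa using h)
    exact absurd hj (not_lt.mpr this)
  rcases lt_or_gt_of_ne h1 with h | h
  · right; exact ⟨i, by simpa using h, fun j hj => by simp [h2 j hj]⟩
  · left; exact ⟨i, h, h2⟩

lemma exists_small {m : ℕ} (c a : Fin m → ℝ) (hc : ∀ j, 0 ≤ c j) (h : ∀ j, 0 < a j → 0 < c j) :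
    ∃ t : ℝ, 0 < t ∧ ∀ j, t * a j ≤ c j := by
  have : ∀ j, ∀ᶠ t in nhdsWithin (0:ℝ) (Set.Ioi 0), t * a j ≤ c j := by
    intro j
    by_cases ha : 0 < a j
    · have h1 : Filter.Tendsto (fun t : ℝ => t * a j) (nhdsWithin 0 (Set.Ioi 0)) (nhds (0 * a j)) :=
        ((continuous_id.mul continuous_const).tendsto 0).mono_left nhdsWithin_le_nhds
      rw [zero_mul] at h1
      exact (h1.eventually (gt_mem_nhds (h j ha))).mono fun t ht => ht.le
    · filter_upwards [self_mem_nhdsWithin] with t ht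
      have : t * a j ≤ 0 := mul_nonpos_of_nonneg_of_nonpos (le_of_lt ht) (not_lt.mp ha)
      linarith [hc j]
  have h2 := (Filter.eventually_all.mpr this).and (self_mem_nhdsWithin (a := (0:ℝ)) (s := Set.Ioi 0))
  obtain ⟨t, ht, ht0⟩ := h2.exists
  exact ⟨t, ht0, ht⟩

lemma IsMn.not_lexpos {d m : ℕ} {w : Fin m → EE d} {c : Fin m → ℝ} (hc : IsMn w c)
    (a : Fin m → ℝ) (ha : ∑ j, a j • w j = 0) (h : ∀ j, 0 < a j → 0 < c j) : ¬ lexpos a := by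
  obtain ⟨t, ht, hta⟩ := exists_small c a hc.1 h
  rintro ⟨i, hi, hj⟩
  refine hc.2 (fun j => t * a j) hta ?_ ⟨i, by positivity, fun j h => by simp [hj j h]⟩
  simp only [mul_smul, ← Finset.smul_sum, ha, smul_zero]

lemma IsMn.sub {d m : ℕ} {w : Fin m → EE d} {c c' : Fin m → ℝ} (hc : IsMn w c)
    (h0 : ∀ j, 0 ≤ c' j) (h : ∀ j, c' j ≠ 0 → c j ≠ 0) : IsMn w c' := by
  refine ⟨h0, fun a ha hs => hc.not_lexpos a hs fun j hj => ?_⟩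
  exact lt_of_le_of_ne (hc.1 j) (h j (by linarith [ha j])).symm

lemma IsMn.uniq {d m : ℕ} {w : Fin m → EE d} {c c' : Fin m → ℝ} (hc : IsMn w c) (hc' : IsMn w c')
    (h : ∑ j, c j • w j = ∑ j, c' j • w j) : c = c' := by
  by_contra hne
  rcases lexpos_or (c - c') (sub_ne_zero.mpr hne) with hl | hl
  · refine hc.2 _ (fun j => ?_) ?_ hl
    · simpa using hc'.1 j
    · simp [sub_smul, h]
  · refine hc'.2 _ (fun j => ?_) ?_ hl
    · simpa using hc.1 j
    · simp [sub_smul, h]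

lemma IsMn.indep {d m : ℕ} {w : Fin m → EE d} {c : Fin m → ℝ} (hc : IsMn w c)
    (a : Fin m → ℝ) (ha : ∑ j, a j • w j = 0) (h : ∀ j, a j ≠ 0 → c j ≠ 0) : a = 0 := by
  by_contra hne
  have h' : ∀ j, a j ≠ 0 → 0 < c j := fun j hj => lt_of_le_of_ne (hc.1 j) (h j hj).symm
  rcases lexpos_or a hne with hl | hl
  · exact hc.not_lexpos a ha (fun j hj => h' j hj.ne') hl
  · refine hc.not_lexpos (-a) (by simp [ha]) (fun j hj => h' j ?_) hl
    intro h; simp [h] at hj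

lemma lex_exists {m : ℕ} (K : Set (Fin m → ℝ)) (hK : IsCompact K) (hne : K.Nonempty) :
    ∃ c ∈ K, ∀ c' ∈ K, ¬ lexpos (c - c') := by
  have key : ∀ k : ℕ, ∃ K' ⊆ K, IsCompact K' ∧ K'.Nonempty ∧
      (∀ c ∈ K', ∀ c' ∈ K, ∀ i : Fin m, (i:ℕ) < k → 0 < (c - c') i →
        ¬ ∀ j < i, (c - c') j = 0) ∧
      (∀ c ∈ K', ∀ c' ∈ K, (∀ i : Fin m, (i:ℕ) < k → (c - c') i = 0) → c' ∈ K') := by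
    intro k
    induction k with
    | zero => exact ⟨K, subset_rfl, hK, hne, by simp, fun _ _ c' h _ => h⟩
    | succ k ih =>
      obtain ⟨K', hs, hc, hn, h1, h2⟩ := ih
      by_cases hk : k < m
      · obtain ⟨c0, hc0, hmin⟩ := hc.exists_isMinOn hn
          (continuous_apply (A := fun _ : Fin m => ℝ) (⟨k, hk⟩ : Fin m)).continuousOn
        have hmin' : ∀ c ∈ K', c0 ⟨k, hk⟩ ≤ c ⟨k, hk⟩ := fun c hc => hmin hc
        refine ⟨K' ∩ {c | c ⟨k, hk⟩ = c0 ⟨k, hk⟩}, fun x hx => hs hx.1, hc.inter_right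
          (isClosed_eq (continuous_apply _) continuous_const), ⟨c0, hc0, rfl⟩, ?_, ?_⟩
        · rintro c ⟨hcK, hck⟩ c' hc' i hi hpos hj
          rcases Nat.lt_succ_iff_lt_or_eq.mp hi with h | h
          · exact h1 c hcK c' hc' i h hpos hj
          · have hik : i = ⟨k, hk⟩ := Fin.ext h
            subst hik
            have := h2 c hcK c' hc' (fun i hi => hj i (by simpa [Fin.lt_def] using hi))
            have := hmin' c' this
            simp only [Set.mem_ofPred_eq] at hck
            simp only [Pi.sub_apply] at hpos
            linarith
        · rintro c ⟨hcK, hck⟩ c' hc' hi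
          refine ⟨h2 c hcK c' hc' fun i h => hi i (by omega), ?_⟩
          have := hi ⟨k, hk⟩ (by simp)
          simp only [Set.mem_ofPred_eq, Pi.sub_apply] at *
          linarith
      · exact ⟨K', hs, hc, hn, fun c hc c' hc' i _ => h1 c hc c' hc' i (by omega),
          fun c hc c' hc' h => h2 c hc c' hc' fun i hi => h i (by omega)⟩
  obtain ⟨K', hs, -, ⟨c, hc⟩, h1, -⟩ := key m
  refine ⟨c, hs hc, fun c' hc' ⟨i, hi, hj⟩ => h1 c hc c' hc' i i.2 hi hj⟩

lemma IsMn.exists {d m : ℕ} {w : Fin m → EE d} {q : ℕ} (hq : 0 < q) (hw : ∀ j, (w j).2 = q)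
    {y : EE d} (hy : inCone w y) : ∃ c, IsMn w c ∧ ∑ j, c j • w j = y := by
  obtain ⟨c0, h0, h1⟩ := hy
  have hq' : (0:ℝ) < q := by exact_mod_cast hq
  have hcpt : IsCompact {c : Fin m → ℝ | (∀ j, 0 ≤ c j) ∧ ∑ j, c j • w j = y} := by
    have : {c : Fin m → ℝ | (∀ j, 0 ≤ c j) ∧ ∑ j, c j • w j = y} ⊆
        Set.Icc (0 : Fin m → ℝ) (fun _ => y.2 / q) := by
      rintro c ⟨hc, hs⟩
      refine ⟨hc, fun j => ?_⟩
      have hs2 := congrArg Prod.snd hs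
      simp only [Prod.snd_sum, Prod.smul_snd, hw, smul_eq_mul] at hs2
      rw [le_div_iff₀ hq', ← hs2]
      exact Finset.single_le_sum (f := fun j => c j * (q:ℝ)) (fun i _ => mul_nonneg (hc i) hq'.le)
        (Finset.mem_univ j)
    refine IsCompact.of_isClosed_subset isCompact_Icc ?_ this
    apply IsClosed.inter
    · have : {c : Fin m → ℝ | ∀ j, 0 ≤ c j} = Set.Ici 0 := by ext; simp [Pi.le_def]
      change IsClosed {c : Fin m → ℝ | ∀ j, 0 ≤ c j}
      rw [this]; exact isClosed_Ici
    · exact isClosed_eq (by fun_prop) continuous_const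
  obtain ⟨c, hc, hmin⟩ := lex_exists _ hcpt ⟨c0, h0, h1⟩
  refine ⟨c, ⟨hc.1, fun a ha hs hl => hmin (c - a) ⟨fun j => ?_, ?_⟩ ?_⟩, hc.2⟩
  · simpa using ha j
  · simp [sub_smul, hs, hc.2]
  · simpa using hl

abbrev LL (d : ℕ) := (Fin d → ℤ) × ℤ

def emb {d : ℕ} : LL d →+ EE d where
  toFun x := (fun i => (x.1 i : ℝ), (x.2 : ℝ))
  map_zero' := by ext <;> simp
  map_add' x y := by ext <;> simp

lemma emb_snd {d : ℕ} (x : LL d) : (emb x).2 = (x.2 : ℝ) := rfl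
lemma emb_fst {d : ℕ} (x : LL d) (i : Fin d) : (emb x).1 i = (x.1 i : ℝ) := rfl

def slc {d : ℕ} (S : Set (LL d)) (n : ℕ) : Set (Fin d → ℤ) := {x | (x, (n : ℤ)) ∈ S}

noncomputable def gf {d : ℕ} (S : Set (LL d)) : PowerSeries ℤ :=
  PowerSeries.mk fun n => ((slc S n).ncard : ℤ)

def latC {d m : ℕ} (u : Fin m → LL d) : Set (LL d) := {x | inCone (fun j => emb (u j)) (emb x)}

lemma latC_height {d m q : ℕ} {u : Fin m → LL d} (hu : ∀ j, (u j).2 = q) {x : LL d}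
    (hx : x ∈ latC u) : 0 ≤ x.2 := by
  obtain ⟨c, hc, hs⟩ := hx
  have := congrArg Prod.snd hs
  simp only [Prod.snd_sum, Prod.smul_snd, emb_snd, hu, smul_eq_mul] at this
  have h : (0:ℝ) ≤ (x.2 : ℝ) := by
    rw [← this]
    exact Finset.sum_nonneg fun j _ => mul_nonneg (hc j) (by positivity)
  exact_mod_cast h

lemma latC_finite {d m q : ℕ} (hq : 0 < q) {u : Fin m → LL d} (hu : ∀ j, (u j).2 = q) (n : ℕ) :
    (slc (latC u) n).Finite := by
  let M : Fin d → ℤ := fun i => ∑ j, n * |(u j).1 i|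
  refine (Set.finite_Icc (-M) M).subset ?_
  rintro x ⟨c, hc, hs⟩
  have h2 := congrArg Prod.snd hs
  simp only [Prod.snd_sum, Prod.smul_snd, emb_snd, hu, smul_eq_mul] at h2
  have hq' : (1:ℝ) ≤ q := by exact_mod_cast hq
  have hcn : ∀ j, c j ≤ n := by
    intro j
    have h3 := Finset.single_le_sum (f := fun j => c j * ((q:ℤ):ℝ)) (fun i _ => mul_nonneg (hc i) (by positivity))
        (Finset.mem_univ j)
    rw [h2] at h3
    push_cast at h3
    nlinarith [hc j]
  have key : ∀ i, |x i| ≤ M i := by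
    intro i
    have h1 := congrFun (congrArg Prod.fst hs) i
    simp only [Prod.fst_sum, Prod.smul_fst, Finset.sum_apply, Pi.smul_apply, emb_fst, smul_eq_mul] at h1
    have : |(x i : ℝ)| ≤ (M i : ℝ) := by
      rw [← h1]
      refine (Finset.abs_sum_le_sum_abs _ _).trans ?_
      simp only [M]
      push_cast
      refine Finset.sum_le_sum fun j _ => ?_
      rw [abs_mul, abs_of_nonneg (hc j)]
      exact mul_le_mul_of_nonneg_right (hcn j) (abs_nonneg _)
    exact_mod_cast this
  exact ⟨fun i => (abs_le.mp (key i)).1, fun i => (abs_le.mp (key i)).2⟩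

lemma gf_union {d m q : ℕ} (hq : 0 < q) {u : Fin m → LL d} (hu : ∀ j, (u j).2 = q)
    {S T R : Set (LL d)} (hR : R ⊆ latC u) (hd : Disjoint S T) (hU : R = S ∪ T) :
    gf R = gf S + gf T := by
  subst hU
  ext n
  simp only [gf, PowerSeries.coeff_mk, map_add]
  have e : slc (S ∪ T) n = slc S n ∪ slc T n := rfl
  have fin := latC_finite hq hu n
  have hd' : Disjoint (slc S n) (slc T n) := by
    rw [Set.disjoint_left] at hd ⊢
    exact fun x hx hx' => hd hx hx'
  rw [e, Set.ncard_union_eq hd' (fin.subset fun x hx => hR (Or.inl hx))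
    (fin.subset fun x hx => hR (Or.inr hx))]
  push_cast; rfl

lemma gf_empty {d : ℕ} : gf (∅ : Set (LL d)) = 0 := by
  ext n
  simp [gf, slc]

lemma gf_biUnion {d m q : ℕ} (hq : 0 < q) {u : Fin m → LL d} (hu : ∀ j, (u j).2 = q)
    {ι : Type*} (T : Finset ι) (F : ι → Set (LL d)) (R : Set (LL d)) (hR : R ⊆ latC u)
    (h : ∀ x, x ∈ R ↔ ∃ s ∈ T, x ∈ F s)
    (hd : ∀ x, ∀ s ∈ T, ∀ t ∈ T, x ∈ F s → x ∈ F t → s = t) : gf R = ∑ s ∈ T, gf (F s) := by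
  classical
  induction T using Finset.induction_on generalizing R with
  | empty =>
    have : R = ∅ := by ext x; simp [h]
    simp [this, gf_empty]
  | insert a T ha ih =>
    rw [Finset.sum_insert ha, ← ih {x | ∃ s ∈ T, x ∈ F s}]
    · apply gf_union hq hu hR
      · rw [Set.disjoint_left]
        rintro x hx ⟨s, hs, hxs⟩
        have := hd x a (by simp) s (by simp [hs]) hx hxs
        exact ha (this ▸ hs)
      · ext x
        simp [h]
    · rintro x ⟨s, hs, hx⟩
      exact hR ((h x).2 ⟨s, by simp [hs], hx⟩)
    · intro x; rfl
    · intro x s hs t ht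
      exact hd x s (by simp [hs]) t (by simp [ht])

lemma gf_shift {d m q : ℕ} {u : Fin m → LL d} (hu : ∀ j, (u j).2 = q)
    {S : Set (LL d)} (hS : S ⊆ latC u) (j : Fin m) :
    gf {x | x - u j ∈ S} = PowerSeries.X ^ q * gf S := by
  ext n
  rw [PowerSeries.coeff_X_pow_mul']
  simp only [gf, PowerSeries.coeff_mk]
  split_ifs with h
  · congr 1
    have : slc {x | x - u j ∈ S} n = (fun x => x + (u j).1) '' slc S (n - q) := by
      ext x
      have e : ∀ y, (y, ((n - q : ℕ) : ℤ)) = ((y + (u j).1, (n:ℤ)) : LL d) - u j := by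
        intro y
        ext
        · simp
        · simp [hu, Nat.cast_sub h]
      constructor
      · intro hx
        refine ⟨x - (u j).1, ?_, by simp⟩
        change (_, _) ∈ S
        rw [e]
        have hx' : ((x, (n:ℤ)) : LL d) - u j ∈ S := hx
        simpa using hx'
      · rintro ⟨y, hy, rfl⟩
        change (y, _) ∈ S at hy
        rw [e] at hy
        exact hy
    rw [this, Set.ncard_image_of_injective _ (add_left_injective _)]
  · have : slc {x | x - u j ∈ S} n = ∅ := by
      ext x
      simp only [Set.mem_empty_iff_false, iff_false]
      intro hx
      have := latC_height hu (hS hx)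
      simp [hu] at this
      omega
    simp [this]

def gd {m : ℕ} (A : Finset (Fin m)) (j : Fin m) (t : ℝ) : Prop := (j ∈ A → 0 < t) ∧ (j ∉ A → 0 ≤ t)

lemma gd_nonneg {m : ℕ} {A : Finset (Fin m)} {j : Fin m} {t : ℝ} (h : gd A j t) : 0 ≤ t := by
  by_cases hj : j ∈ A
  · exact (h.1 hj).le
  · exact h.2 hj

lemma gd_compl {m : ℕ} (A : Finset (Fin m)) (j : Fin m) (t : ℝ) : gd Aᶜ j (-t) ↔ ¬ gd A j t := by
  by_cases hj : j ∈ A <;> simp [gd, hj]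

lemma gd_add_one {m : ℕ} {A : Finset (Fin m)} {j : Fin m} {t : ℝ} (h : gd A j t) : gd A j (t + 1) :=
  ⟨fun hj => by linarith [h.1 hj], fun hj => by linarith [h.2 hj]⟩

def HO {d m : ℕ} (u : Fin m → LL d) (σ A S : Finset (Fin m)) : Set (LL d) :=
  {x | ∃ c : Fin m → ℝ, ∑ j ∈ σ, c j • emb (u j) = emb x ∧
    ∀ j ∈ σ, gd A j (c j) ∧ (j ∈ S → ¬ gd A j (c j - 1))}

def Ind {d m : ℕ} (u : Fin m → LL d) (σ : Finset (Fin m)) : Prop :=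
  ∀ a : Fin m → ℝ, ∑ j ∈ σ, a j • emb (u j) = 0 → ∀ j ∈ σ, a j = 0

lemma Ind.uniq {d m : ℕ} {u : Fin m → LL d} {σ : Finset (Fin m)} (h : Ind u σ)
    {a b : Fin m → ℝ} (e : ∑ j ∈ σ, a j • emb (u j) = ∑ j ∈ σ, b j • emb (u j)) :
    ∀ j ∈ σ, a j = b j := by
  intro j hj
  have := h (a - b) (by simp [sub_smul, e]) j hj
  simpa [sub_eq_zero] using this

lemma sum_ext {d m : ℕ} (w : Fin m → EE d) (σ : Finset (Fin m)) (c : Fin m → ℝ) :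
    ∑ j, (if j ∈ σ then c j else 0) • w j = ∑ j ∈ σ, c j • w j := by
  simp [ite_smul, Finset.sum_ite_mem]

lemma inCone_sub {d m : ℕ} {w : Fin m → EE d} (σ : Finset (Fin m)) (c : Fin m → ℝ)
    (hc : ∀ j ∈ σ, 0 ≤ c j) : inCone w (∑ j ∈ σ, c j • w j) := by
  refine ⟨fun j => if j ∈ σ then c j else 0, fun j => ?_, sum_ext w σ c⟩
  dsimp only
  split_ifs with h
  · exact hc j h
  · exact le_rfl

lemma HO_sub {d m : ℕ} (u : Fin m → LL d) (σ A S : Finset (Fin m)) : HO u σ A S ⊆ latC u := by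
  rintro x ⟨c, hs, hc⟩
  change inCone _ _
  rw [← hs]
  exact inCone_sub σ c fun j hj => gd_nonneg (hc j hj).1

lemma HO_step {d m q : ℕ} (hq : 0 < q) {u : Fin m → LL d} (hu : ∀ j, (u j).2 = q)
    {σ : Finset (Fin m)} (A S : Finset (Fin m)) (hi : Ind u σ) (k : Fin m) (hk : k ∈ σ)
    (hkS : k ∉ S) :
    (1 - PowerSeries.X ^ q) * gf (HO u σ A S) = gf (HO u σ A (insert k S)) := by
  classical
  have e : ∀ (c : Fin m → ℝ) (t : ℝ),
      ∑ j ∈ σ, (c j + if j = k then t else 0) • emb (u j) = ∑ j ∈ σ, c j • emb (u j) + t • emb (u k) := by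
    intro c t
    simp [add_smul, Finset.sum_add_distrib, ite_smul, hk]
  have h : gf (HO u σ A S) = gf (HO u σ A (insert k S)) + gf {x | x - u k ∈ HO u σ A S} := by
    apply gf_union hq hu (HO_sub u σ A S)
    · rw [Set.disjoint_left]
      rintro x ⟨c, hs, hc⟩ ⟨c', hs', hc'⟩
      have h1 : ∑ j ∈ σ, c j • emb (u j) = ∑ j ∈ σ, (c' j + if j = k then 1 else 0) • emb (u j) := by
        rw [e, hs, hs']; simp
      have h2 := hi.uniq h1 k hk
      have h3 := (hc k hk).2 (by simp)
      have h4 := (hc' k hk).1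
      rw [h2] at h3
      simp at h3
      exact h3 h4
    · ext x
      constructor
      · rintro ⟨c, hs, hc⟩
        by_cases hg : gd A k (c k - 1)
        · right
          refine ⟨fun j => c j + if j = k then -1 else 0, ?_, ?_⟩
          · rw [e, hs]; simp [sub_eq_add_neg]
          · intro j hj
            by_cases hjk : j = k
            · subst hjk
              simp only [if_true, hkS, false_imp_iff, and_true]
              exact hg
            · simp only [hjk, if_false, add_zero]
              exact hc j hj
        · left
          refine ⟨c, hs, fun j hj => ⟨(hc j hj).1, fun hjS => ?_⟩⟩
          rcases Finset.mem_insert.mp hjS with rfl | h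
          · exact hg
          · exact (hc j hj).2 h
      · rintro (⟨c, hs, hc⟩ | ⟨c, hs, hc⟩)
        · exact ⟨c, hs, fun j hj => ⟨(hc j hj).1, fun h => (hc j hj).2 (by simp [h])⟩⟩
        · refine ⟨fun j => c j + if j = k then 1 else 0, ?_, ?_⟩
          · rw [e, hs]; simp
          · intro j hj
            by_cases hjk : j = k
            · subst hjk
              simp only [if_true, hkS, false_imp_iff, and_true]
              exact gd_add_one (hc j hj).1
            · simp only [hjk, if_false, add_zero]
              exact hc j hj
  rw [gf_shift hu (HO_sub u σ A S)] at h
  linear_combination h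

lemma HO_box {d m q : ℕ} (hq : 0 < q) {u : Fin m → LL d} (hu : ∀ j, (u j).2 = q)
    {σ : Finset (Fin m)} (A S : Finset (Fin m)) (hi : Ind u σ) (hS : S ⊆ σ) :
    (1 - PowerSeries.X ^ q) ^ S.card * gf (HO u σ A ∅) = gf (HO u σ A S) := by
  classical
  induction S using Finset.induction_on with
  | empty => simp
  | insert k S hk ih =>
    rw [Finset.card_insert_of_notMem hk, pow_succ', mul_assoc,
      ih (fun x hx => hS (by simp [hx])), HO_step hq hu A S hi k (hS (by simp)) hk]

lemma box_coeff_zero {d m q : ℕ} {u : Fin m → LL d} (hu : ∀ j, (u j).2 = q)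
    (σ A : Finset (Fin m)) (n : ℕ) (hn : q * σ.card < n) :
    PowerSeries.coeff n (gf (HO u σ A σ)) = 0 := by
  simp only [gf, PowerSeries.coeff_mk]
  have : slc (HO u σ A σ) n = ∅ := by
    ext x
    simp only [Set.mem_empty_iff_false, iff_false]
    rintro ⟨c, hs, hc⟩
    have h2 := congrArg Prod.snd hs
    simp only [Prod.snd_sum, Prod.smul_snd, emb_snd, hu, smul_eq_mul] at h2
    have h3 : ∑ j ∈ σ, c j * ((q:ℤ):ℝ) ≤ ∑ j ∈ σ, ((q:ℤ):ℝ) := by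
      refine Finset.sum_le_sum fun j hj => ?_
      have h1 : c j ≤ 1 := by
        have := gd_nonneg ((gd_compl A j _).2 ((hc j hj).2 hj))
        linarith
      have : (0:ℝ) ≤ ((q:ℤ):ℝ) := by positivity
      nlinarith
    rw [h2, Finset.sum_const, nsmul_eq_mul] at h3
    have : n ≤ σ.card * q := by exact_mod_cast h3
    rw [mul_comm] at this
    omega
  simp [this]

lemma box_symm {d m q : ℕ} {u : Fin m → LL d} (hu : ∀ j, (u j).2 = q)
    (σ A : Finset (Fin m)) (n k : ℕ) (hn : n + k = q * σ.card) :
    PowerSeries.coeff n (gf (HO u σ A σ)) = PowerSeries.coeff k (gf (HO u σ Aᶜ σ)) := by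
  have main : ∀ A x, x ∈ HO u σ A σ → ∑ j ∈ σ, u j - x ∈ HO u σ Aᶜ σ := by
    rintro A x ⟨c, hs, hc⟩
    refine ⟨fun j => 1 - c j, ?_, fun j hj => ⟨?_, fun _ => ?_⟩⟩
    · simp [sub_smul, hs]
    · have := (gd_compl A j _).2 ((hc j hj).2 hj)
      simpa using this
    · have : 1 - c j - 1 = - c j := by ring
      rw [this, gd_compl, not_not]
      exact (hc j hj).1
  have hsum : (∑ j ∈ σ, u j).2 = (n:ℤ) + k := by
    rw [Prod.snd_sum]; simp only [hu, Finset.sum_const, nsmul_eq_mul]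
    rw [mul_comm]; exact_mod_cast hn.symm
  simp only [gf, PowerSeries.coeff_mk]
  congr 1
  have : slc (HO u σ Aᶜ σ) k = (fun x => (∑ j ∈ σ, u j).1 - x) '' slc (HO u σ A σ) n := by
    have e1 : ∀ x, (((∑ j ∈ σ, u j).1 - x, (k:ℤ)) : LL d) = ∑ j ∈ σ, u j - (x, (n:ℤ)) := by
      intro x; ext
      · simp
      · simp [hsum]
    have e2 : ∀ x, (((∑ j ∈ σ, u j).1 - x, (n:ℤ)) : LL d) = ∑ j ∈ σ, u j - (x, (k:ℤ)) := by
      intro x; ext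
      · simp
      · simp [hsum]
    ext x
    constructor
    · intro hx
      refine ⟨(∑ j ∈ σ, u j).1 - x, ?_, by simp⟩
      have := main Aᶜ _ hx
      rw [compl_compl] at this
      change (((∑ j ∈ σ, u j).1 - x, (n:ℤ)) : LL d) ∈ HO u σ A σ
      rw [e2]; exact this
    · rintro ⟨y, hy, rfl⟩
      change (((∑ j ∈ σ, u j).1 - y, (k:ℤ)) : LL d) ∈ HO u σ Aᶜ σ
      rw [e1]; exact main A _ hy
  rw [this, Set.ncard_image_of_injective _ (sub_right_injective)]

open Filter Topology

lemma Ind.linInd {d m : ℕ} {u : Fin m → LL d} {σ : Finset (Fin m)} (h : Ind u σ) :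
    LinearIndependent ℝ (fun j : σ => emb (u j)) := by
  classical
  rw [Fintype.linearIndependent_iff]
  intro g hg i
  have := h (fun j => if hj : j ∈ σ then g ⟨j, hj⟩ else 0) ?_ i i.2
  · simpa using this
  · rw [← Finset.sum_attach, ← hg]
    simp [Finset.univ_eq_attach]

lemma finrank_EE (d : ℕ) : Module.finrank ℝ (EE d) = d + 1 := by simp [EE]

lemma Ind.card_le {d m : ℕ} {u : Fin m → LL d} {σ : Finset (Fin m)} (h : Ind u σ) :
    σ.card ≤ d + 1 := by
  have := h.linInd.fintype_card_le_finrank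
  rwa [finrank_EE, Fintype.card_coe] at this

def Wsp {d m : ℕ} (u : Fin m → LL d) (σ : Finset (Fin m)) : Submodule ℝ (EE d) :=
  Submodule.span ℝ (Set.range (fun j : σ => emb (u j)))

lemma sum_mem_Wsp {d m : ℕ} (u : Fin m → LL d) (σ : Finset (Fin m)) (c : Fin m → ℝ) :
    ∑ j ∈ σ, c j • emb (u j) ∈ Wsp u σ :=
  Submodule.sum_mem _ fun j hj => Submodule.smul_mem _ _ (Submodule.subset_span ⟨⟨j, hj⟩, rfl⟩)

lemma Ind.span {d m : ℕ} {u : Fin m → LL d} {σ : Finset (Fin m)} (h : Ind u σ)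
    (hc : σ.card = d + 1) (y : EE d) : ∃ c : Fin m → ℝ, ∑ j ∈ σ, c j • emb (u j) = y := by
  classical
  have h1 := h.linInd.span_eq_top_of_card_eq_finrank' (by rw [finrank_EE, Fintype.card_coe, hc])
  have hy : y ∈ Submodule.span ℝ (Set.range (fun j : σ => emb (u j))) := by rw [h1]; trivial
  obtain ⟨g, hg⟩ := (Submodule.mem_span_range_iff_exists_fun ℝ).1 hy
  refine ⟨fun j => if hj : j ∈ σ then g ⟨j, hj⟩ else 0, ?_⟩
  rw [← Finset.sum_attach, ← hg]
  simp [Finset.univ_eq_attach]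

lemma Wsp_ne_top {d m : ℕ} (u : Fin m → LL d) (σ : Finset (Fin m)) (hc : σ.card ≤ d) :
    Wsp u σ ≠ ⊤ := by
  intro h
  have h1 := finrank_range_le_card (R := ℝ) (fun j : σ => emb (u j))
  have h2 : Module.finrank ℝ (Wsp u σ) = d + 1 := by rw [h, finrank_top, finrank_EE]
  have h3 : Module.finrank ℝ (Wsp u σ) ≤ σ.card := by
    rw [Fintype.card_coe] at h1
    exact h1
  omega

lemma avoid {d : ℕ} (W : Submodule ℝ (EE d)) (ξ y : EE d) (h : ξ ∉ W) :
    ∀ᶠ ε in 𝓝[>] (0:ℝ), y + ε • ξ ∉ W := by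
  by_cases hex : ∃ e : ℝ, y + e • ξ ∈ W
  · obtain ⟨e, he⟩ := hex
    have hne : ∀ᶠ ε in 𝓝[>] (0:ℝ), ε ≠ e := by
      rcases le_or_gt e 0 with h0 | h0
      · filter_upwards [self_mem_nhdsWithin] with ε hε
        exact (lt_of_le_of_lt h0 hε).ne'
      · filter_upwards [nhdsWithin_le_nhds (gt_mem_nhds h0)] with ε hε
        exact ne_of_lt hε
    filter_upwards [hne] with ε hε hm
    apply h
    have h2 := W.sub_mem hm he
    have h3 : y + ε • ξ - (y + e • ξ) = (ε - e) • ξ := by rw [sub_smul]; abel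
    rw [h3] at h2
    exact (W.smul_mem_iff (sub_ne_zero.mpr hε)).1 h2
  · push Not at hex
    exact Eventually.of_forall fun e => hex e

lemma small_sign (b X : ℝ) (hX : X ≠ 0) :
    ∀ᶠ ε in 𝓝[>] (0:ℝ), (0 < b + ε * X ↔ (X < 0 → 0 < b) ∧ (¬ X < 0 → 0 ≤ b)) := by
  have ht : Tendsto (fun ε : ℝ => b + ε * X) (𝓝[>] 0) (𝓝 b) := by
    have : Tendsto (fun ε : ℝ => b + ε * X) (𝓝 0) (𝓝 (b + 0 * X)) :=
      (by fun_prop : Continuous fun ε : ℝ => b + ε * X).tendsto 0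
    simpa using this.mono_left nhdsWithin_le_nhds
  rcases lt_trichotomy b 0 with hb | hb | hb
  · filter_upwards [ht.eventually (gt_mem_nhds hb)] with ε hε
    constructor
    · intro h; linarith
    · rintro ⟨h1, h2⟩
      by_cases hx : X < 0
      · linarith [h1 hx]
      · linarith [h2 hx]
  · subst hb
    filter_upwards [self_mem_nhdsWithin] with ε hε
    have hε : 0 < ε := hε
    simp only [zero_add, mul_pos_iff_of_pos_left hε, lt_self_iff_false, le_refl, imp_true_iff, and_true]
    constructor
    · intro h h'; linarith
    · intro h; exact lt_of_le_of_ne (not_lt.mp h) hX.symm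
  · filter_upwards [ht.eventually (lt_mem_nhds hb)] with ε hε
    exact ⟨fun _ => ⟨fun _ => hb, fun _ => hb.le⟩, fun _ => hε⟩

open Classical in
noncomputable def Del {d m : ℕ} (u : Fin m → LL d) : Finset (Finset (Fin m)) :=
  Finset.univ.filter fun σ => ∃ c, IsMn (fun j => emb (u j)) c ∧ ∀ j, j ∈ σ ↔ c j ≠ 0

lemma mem_Del {d m : ℕ} {u : Fin m → LL d} {σ : Finset (Fin m)} :
    σ ∈ Del u ↔ ∃ c, IsMn (fun j => emb (u j)) c ∧ ∀ j, j ∈ σ ↔ c j ≠ 0 := by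
  simp [Del]

lemma Del_ind {d m : ℕ} {u : Fin m → LL d} {σ : Finset (Fin m)} (h : σ ∈ Del u) : Ind u σ := by
  obtain ⟨c, hc, hs⟩ := mem_Del.1 h
  intro a ha j hj
  have := hc.indep (fun j => if j ∈ σ then a j else 0) (by rw [sum_ext]; exact ha)
    (fun j hj => (hs j).1 (by by_contra h; simp [h] at hj))
  have := congrFun this j
  simpa [hj] using this

lemma Del_isMn {d m : ℕ} {u : Fin m → LL d} {σ : Finset (Fin m)} (h : σ ∈ Del u) (c : Fin m → ℝ)
    (hc : ∀ j ∈ σ, 0 ≤ c j) : IsMn (fun j => emb (u j)) (fun j => if j ∈ σ then c j else 0) := by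
  obtain ⟨c', hc', hs⟩ := mem_Del.1 h
  refine hc'.sub (fun j => ?_) fun j hj => (hs j).1 (by by_contra h; simp [h] at hj)
  split_ifs with hj
  · exact hc j hj
  · exact le_rfl

lemma Del_uniq {d m : ℕ} {u : Fin m → LL d} {σ τ : Finset (Fin m)} (h : σ ∈ Del u) (h' : τ ∈ Del u)
    (c c' : Fin m → ℝ) (hc : ∀ j ∈ σ, 0 < c j) (hc' : ∀ j ∈ τ, 0 < c' j)
    (e : ∑ j ∈ σ, c j • emb (u j) = ∑ j ∈ τ, c' j • emb (u j)) : σ = τ := by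
  have := (Del_isMn h c fun j hj => (hc j hj).le).uniq (Del_isMn h' c' fun j hj => (hc' j hj).le)
    (by rw [sum_ext, sum_ext, e])
  ext j
  have hj := congrFun this j
  constructor
  · intro h1
    by_contra h2
    simp only [h1, h2, if_true, if_false] at hj
    exact (hc j h1).ne' hj
  · intro h1
    by_contra h2
    simp only [h1, h2, if_true, if_false] at hj
    exact (hc' j h1).ne hj

lemma Del_exists {d m q : ℕ} (hq : 0 < q) {u : Fin m → LL d} (hu : ∀ j, (u j).2 = q) {y : EE d}
    (hy : inCone (fun j => emb (u j)) y) :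
    ∃ σ ∈ Del u, ∃ c : Fin m → ℝ, (∀ j ∈ σ, 0 < c j) ∧ ∑ j ∈ σ, c j • emb (u j) = y := by
  classical
  obtain ⟨c, hc, hs⟩ := IsMn.exists hq (fun j => by rw [emb_snd, hu]; simp) hy
  refine ⟨Finset.univ.filter fun j => c j ≠ 0, mem_Del.2 ⟨c, hc, by simp⟩, c, ?_, ?_⟩
  · intro j hj
    exact lt_of_le_of_ne (hc.1 j) (by simpa using hj : c j ≠ 0).symm
  · rw [← hs, Finset.sum_filter]
    refine Finset.sum_congr rfl fun j _ => ?_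
    by_cases h : c j = 0 <;> simp [h]

noncomputable def TT {d m : ℕ} (u : Fin m → LL d) : Finset (Finset (Fin m)) :=
  (Del u).filter fun σ => σ.card = d + 1

def Gen {d m : ℕ} (u : Fin m → LL d) (ξ : EE d) : Prop := ∀ σ, σ.card ≤ d → ξ ∉ Wsp u σ

lemma Gen.coord_ne {d m : ℕ} {u : Fin m → LL d} {ξ : EE d} (hg : Gen u ξ) {σ : Finset (Fin m)}
    (hc : σ.card = d + 1) {X : Fin m → ℝ} (hX : ∑ j ∈ σ, X j • emb (u j) = ξ) {j : Fin m}
    (hj : j ∈ σ) : X j ≠ 0 := by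
  classical
  intro h0
  apply hg (σ.erase j) (by rw [Finset.card_erase_of_mem hj]; omega)
  rw [← hX, ← Finset.add_sum_erase _ _ hj, h0, zero_smul, zero_add]
  exact sum_mem_Wsp u _ X

section D
variable {d m q : ℕ} (hq : 0 < q) {u : Fin m → LL d} (hu : ∀ j, (u j).2 = q) {ξ : EE d}
    (hg : Gen u ξ) (X : Finset (Fin m) → Fin m → ℝ)
    (hX : ∀ σ ∈ TT u, ∑ j ∈ σ, X σ j • emb (u j) = ξ) (A : Finset (Fin m) → Finset (Fin m))
    (hA : ∀ σ ∈ TT u, ∀ j ∈ σ, (j ∈ A σ ↔ X σ j < 0))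

include hg hX hA in
lemma D_sign {σ : Finset (Fin m)} (hσ : σ ∈ TT u) (b : Fin m → ℝ) :
    ∀ᶠ ε in 𝓝[>] (0:ℝ), ∀ j ∈ σ, (0 < b j + ε * X σ j ↔ gd (A σ) j (b j)) := by
  rw [Filter.eventually_all_finset]
  intro j hj
  have hne := hg.coord_ne (Finset.mem_filter.1 hσ).2 (hX σ hσ) hj
  filter_upwards [small_sign (b j) (X σ j) hne] with ε hε
  rw [hε, gd, hA σ hσ j hj]

include hX in
lemma D_sum {σ : Finset (Fin m)} (hσ : σ ∈ TT u) (b : Fin m → ℝ) (ε : ℝ) :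
    ∑ j ∈ σ, (b j + ε * X σ j) • emb (u j) = ∑ j ∈ σ, b j • emb (u j) + ε • ξ := by
  simp [add_smul, Finset.sum_add_distrib, mul_smul, ← Finset.smul_sum, hX σ hσ]

include hg hX hA in
lemma D_b {σ : Finset (Fin m)} (hσ : σ ∈ TT u) (b : Fin m → ℝ) (hb : ∀ j ∈ σ, gd (A σ) j (b j)) :
    ∀ᶠ ε in 𝓝[>] (0:ℝ), ∃ c : Fin m → ℝ, (∀ j ∈ σ, 0 < c j) ∧
      ∑ j ∈ σ, c j • emb (u j) = ∑ j ∈ σ, b j • emb (u j) + ε • ξ := by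
  filter_upwards [D_sign hg X hX A hA hσ b] with ε hε
  exact ⟨fun j => b j + ε * X σ j, fun j hj => (hε j hj).2 (hb j hj), D_sum X hX hσ b ε⟩

include hg hX hA in
lemma D_uniq {σ τ : Finset (Fin m)} (hσ : σ ∈ TT u) (hτ : τ ∈ TT u) (b b' : Fin m → ℝ)
    (hb : ∀ j ∈ σ, gd (A σ) j (b j)) (hb' : ∀ j ∈ τ, gd (A τ) j (b' j))
    (e : ∑ j ∈ σ, b j • emb (u j) = ∑ j ∈ τ, b' j • emb (u j)) : σ = τ := by
  obtain ⟨ε, ⟨c, hc, h1⟩, ⟨c', hc', h2⟩⟩ :=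
    ((D_b hg X hX A hA hσ b hb).and (D_b hg X hX A hA hτ b' hb')).exists
  exact Del_uniq (Finset.mem_filter.1 hσ).1 (Finset.mem_filter.1 hτ).1 c c' hc hc'
    (by rw [h1, h2, e])

include hq hu hg hX hA in
lemma D_a (y : EE d) (hy : ∀ᶠ ε in 𝓝[>] (0:ℝ), inCone (fun j => emb (u j)) (y + ε • ξ)) :
    ∃ σ ∈ TT u, ∃ b : Fin m → ℝ, ∑ j ∈ σ, b j • emb (u j) = y ∧ ∀ j ∈ σ, gd (A σ) j (b j) := by
  have hsp : ∀ σ : Finset (Fin m), ∃ b : Fin m → ℝ, σ ∈ TT u → ∑ j ∈ σ, b j • emb (u j) = y := by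
    intro σ
    by_cases h : σ ∈ TT u
    · obtain ⟨b, hb⟩ := (Del_ind (Finset.mem_filter.1 h).1).span (Finset.mem_filter.1 h).2 y
      exact ⟨b, fun _ => hb⟩
    · exact ⟨0, fun h' => absurd h' h⟩
  choose b hb using hsp
  have h1 : ∀ᶠ ε in 𝓝[>] (0:ℝ), ∀ σ ∈ TT u, ∀ j ∈ σ,
      (0 < b σ j + ε * X σ j ↔ gd (A σ) j (b σ j)) := by
    rw [Filter.eventually_all_finset]
    intro σ hσ
    exact D_sign hg X hX A hA hσ (b σ)
  have h2 : ∀ᶠ ε in 𝓝[>] (0:ℝ), ∀ σ : Finset (Fin m), σ.card ≤ d → y + ε • ξ ∉ Wsp u σ := by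
    rw [Filter.eventually_all]
    intro σ
    by_cases h : σ.card ≤ d
    · filter_upwards [avoid (Wsp u σ) ξ y (hg σ h)] with ε hε _ using hε
    · exact Eventually.of_forall fun _ h' => absurd h' h
  obtain ⟨ε, hy, h1, h2⟩ := (hy.and (h1.and h2)).exists
  obtain ⟨σ, hσ, c, hc, hs⟩ := Del_exists hq hu hy
  have hind := Del_ind hσ
  have hT : σ ∈ TT u := by
    refine Finset.mem_filter.2 ⟨hσ, ?_⟩
    by_contra hne
    have := hind.card_le
    exact h2 σ (by omega) (hs ▸ sum_mem_Wsp u σ c)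
  refine ⟨σ, hT, b σ, hb σ hT, fun j hj => (h1 σ hT j hj).1 ?_⟩
  have := hind.uniq (a := c) (b := fun j => b σ j + ε * X σ j)
    (by rw [hs, D_sum X hX hT, hb σ hT]) j hj
  rw [← this]; exact hc j hj

end D

def latI {d m : ℕ} (u : Fin m → LL d) (ξ : EE d) : Set (LL d) :=
  {x | ∃ t : ℝ, 0 < t ∧ inCone (fun j => emb (u j)) (emb x - t • ξ)}

lemma inCone.add {d m : ℕ} {w : Fin m → EE d} {x y : EE d} (hx : inCone w x) (hy : inCone w y) :
    inCone w (x + y) := by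
  obtain ⟨c, hc, rfl⟩ := hx
  obtain ⟨c', hc', rfl⟩ := hy
  exact ⟨fun j => c j + c' j, fun j => add_nonneg (hc j) (hc' j),
    by simp [add_smul, Finset.sum_add_distrib]⟩

lemma inCone.smul {d m : ℕ} {w : Fin m → EE d} {x : EE d} (hx : inCone w x) {t : ℝ} (ht : 0 ≤ t) :
    inCone w (t • x) := by
  obtain ⟨c, hc, rfl⟩ := hx
  exact ⟨fun j => t * c j, fun j => mul_nonneg ht (hc j), by simp [mul_smul, Finset.smul_sum]⟩

lemma latI_sub {d m : ℕ} {u : Fin m → LL d} {ξ : EE d} (hξ : inCone (fun j => emb (u j)) ξ) :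
    latI u ξ ⊆ latC u := by
  rintro x ⟨t, ht, hx⟩
  have := hx.add (hξ.smul ht.le)
  rw [sub_add_cancel] at this
  exact this

lemma Gen.neg {d m : ℕ} {u : Fin m → LL d} {ξ : EE d} (hg : Gen u ξ) : Gen u (-ξ) := by
  intro σ hσ h
  exact hg σ hσ (by simpa using h)

lemma relint_dich {d m : ℕ} {u : Fin m → LL d} {ξ : EE d} {σ : Finset (Fin m)} {b c : Fin m → ℝ}
    (hb : ∀ j ∈ σ, 0 < b j) {x y : EE d} (hbs : ∑ j ∈ σ, b j • emb (u j) = y)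
    (hcs : ∑ j ∈ σ, c j • emb (u j) = x)
    (hx : ∃ t : ℝ, 0 < t ∧ inCone (fun j => emb (u j)) (x - t • ξ)) :
    ∃ t : ℝ, 0 < t ∧ inCone (fun j => emb (u j)) (y - t • ξ) := by
  obtain ⟨s, hs, hsc⟩ := exists_small (fun j => if j ∈ σ then b j else 0)
    (fun j => if j ∈ σ then c j else 0)
    (fun j => by split_ifs with h; exacts [(hb j h).le, le_rfl])
    (fun j => by split_ifs with h; exacts [fun _ => hb j h, fun h => h])
  obtain ⟨t, ht, hx⟩ := hx
  refine ⟨s * t, by positivity, ?_⟩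
  have h1 : inCone (fun j => emb (u j)) (y - s • x) := by
    have : y - s • x = ∑ j ∈ σ, (b j - s * c j) • emb (u j) := by
      simp [sub_smul, mul_smul, ← Finset.smul_sum, hbs, hcs]
    rw [this]
    refine inCone_sub σ _ fun j hj => ?_
    have := hsc j
    simp only [hj, if_true] at this
    linarith
  have h2 := h1.add (hx.smul hs.le)
  have e : y - s • x + s • (x - t • ξ) = y - (s * t) • ξ := by
    rw [smul_sub, mul_smul]; abel
  rwa [e] at h2

section core
variable {d m q : ℕ} (hq : 0 < q) {u : Fin m → LL d} (hu : ∀ j, (u j).2 = q) {ξ : EE d}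
    (hg : Gen u ξ) (hξ : inCone (fun j => emb (u j)) ξ)

lemma T_ind {d m : ℕ} {u : Fin m → LL d} {σ : Finset (Fin m)} (h : σ ∈ TT u) : Ind u σ :=
  Del_ind (Finset.mem_filter.1 h).1

include hq hu hg hξ in
lemma core_T : ∃ A : Finset (Fin m) → Finset (Fin m),
    gf (latC u) = ∑ σ ∈ TT u, gf (HO u σ (A σ) ∅) ∧
    gf (latI u ξ) = ∑ σ ∈ TT u, gf (HO u σ (A σ)ᶜ ∅) := by
  classical
  have hsp : ∀ σ : Finset (Fin m), ∃ b : Fin m → ℝ, σ ∈ TT u → ∑ j ∈ σ, b j • emb (u j) = ξ := by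
    intro σ
    by_cases h : σ ∈ TT u
    · obtain ⟨b, hb⟩ := (T_ind h).span (Finset.mem_filter.1 h).2 ξ
      exact ⟨b, fun _ => hb⟩
    · exact ⟨0, fun h' => absurd h' h⟩
  choose X hX using hsp
  let A : Finset (Fin m) → Finset (Fin m) := fun σ => Finset.univ.filter fun j => X σ j < 0
  have hA : ∀ σ ∈ TT u, ∀ j ∈ σ, (j ∈ A σ ↔ X σ j < 0) := by
    intro σ _ j _; simp [A]
  have hX' : ∀ σ ∈ TT u, ∑ j ∈ σ, (fun σ j => - X σ j) σ j • emb (u j) = -ξ := by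
    intro σ hσ; simp [hX σ hσ]
  have hA' : ∀ σ ∈ TT u, ∀ j ∈ σ, (j ∈ (fun σ => (A σ)ᶜ) σ ↔ (fun σ j => - X σ j) σ j < 0) := by
    intro σ hσ j hj
    have := hg.coord_ne (Finset.mem_filter.1 hσ).2 (hX σ hσ) hj
    simp only [A, Finset.mem_compl, Finset.mem_filter, Finset.mem_univ, true_and, not_lt]
    constructor
    · intro h
      have := lt_of_le_of_ne h this.symm
      linarith
    · intro h; linarith
  refine ⟨A, gf_biUnion hq hu _ _ _ subset_rfl (fun x => ⟨fun hx => ?_, ?_⟩) ?_,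
    gf_biUnion hq hu _ _ _ (latI_sub hξ) (fun x => ⟨fun hx => ?_, ?_⟩) ?_⟩
  · obtain ⟨σ, hσ, b, hb, hb'⟩ := D_a hq hu hg X hX A hA (emb x) (by
      filter_upwards [self_mem_nhdsWithin] with ε hε
      exact inCone.add hx (hξ.smul (le_of_lt hε)))
    exact ⟨σ, hσ, b, hb, fun j hj => ⟨hb' j hj, by simp⟩⟩
  · rintro ⟨σ, hσ, hx⟩
    exact HO_sub _ _ _ _ hx
  · rintro x σ hσ τ hτ ⟨b, hb, hb'⟩ ⟨c, hc, hc'⟩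
    exact D_uniq hg X hX A hA hσ hτ b c (fun j hj => (hb' j hj).1) (fun j hj => (hc' j hj).1)
      (by rw [hb, hc])
  · obtain ⟨t, ht, hxt⟩ := hx
    obtain ⟨σ, hσ, b, hb, hb'⟩ := D_a hq hu hg.neg _ hX' _ hA' (emb x) (by
      filter_upwards [self_mem_nhdsWithin, nhdsWithin_le_nhds (gt_mem_nhds ht)] with ε hε hεt
      have := hxt.add (hξ.smul (sub_nonneg.2 (le_of_lt hεt)))
      have e : emb x - t • ξ + (t - ε) • ξ = emb x + ε • -ξ := by
        rw [sub_smul, smul_neg]; abel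
      rwa [e] at this)
    exact ⟨σ, hσ, b, hb, fun j hj => ⟨hb' j hj, by simp⟩⟩
  · rintro ⟨σ, hσ, b, hb, hb'⟩
    obtain ⟨ε, ⟨c, hc, hs⟩, hε⟩ := ((D_b hg.neg _ hX' _ hA' hσ b (fun j hj => (hb' j hj).1)).and
      self_mem_nhdsWithin).exists
    refine ⟨ε, hε, ?_⟩
    have : emb x - ε • ξ = ∑ j ∈ σ, c j • emb (u j) := by
      rw [hs, hb, smul_neg, sub_eq_add_neg]
    rw [this]
    exact inCone_sub σ c fun j hj => (hc j hj).le
  · rintro x σ hσ τ hτ ⟨b, hb, hb'⟩ ⟨c, hc, hc'⟩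
    exact D_uniq hg.neg _ hX' _ hA' hσ hτ b c (fun j hj => (hb' j hj).1) (fun j hj => (hc' j hj).1)
      (by rw [hb, hc])

lemma gd_univ {m : ℕ} (j : Fin m) (t : ℝ) : gd Finset.univ j t ↔ 0 < t := by simp [gd]

include hq hu in
lemma core_B : ∃ D : Finset (Finset (Fin m)), (∀ σ ∈ D, Ind u σ ∧ σ.card ≤ d) ∧
    gf (latC u \ latI u ξ) = ∑ σ ∈ D, gf (HO u σ Finset.univ ∅) := by
  classical
  refine ⟨(Del u).filter fun σ => ∀ x ∈ HO u σ Finset.univ ∅, x ∉ latI u ξ, ?_, ?_⟩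
  · intro σ hσ
    obtain ⟨hσ, h⟩ := Finset.mem_filter.1 hσ
    have hi := Del_ind hσ
    refine ⟨hi, ?_⟩
    by_contra hne
    have hle := hi.card_le
    have hx : ∑ j ∈ σ, u j ∈ HO u σ Finset.univ ∅ :=
      ⟨fun _ => 1, by simp, fun j _ => ⟨by simp [gd], by simp⟩⟩
    apply h _ hx
    obtain ⟨c, hc⟩ := hi.span (by omega) ξ
    refine relint_dich (u := u) (ξ := ξ) (σ := σ) (b := fun _ => 1) (c := c) (x := ξ)
      (fun _ _ => one_pos) (by simp) hc ⟨1, one_pos, 0, by simp, by simp⟩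
  · refine gf_biUnion hq hu _ _ _ Set.sdiff_subset (fun x => ⟨?_, ?_⟩) ?_
    · rintro ⟨hx, hxI⟩
      obtain ⟨σ, hσ, c, hc, hs⟩ := Del_exists hq hu hx
      refine ⟨σ, Finset.mem_filter.2 ⟨hσ, ?_⟩, c, hs, fun j hj => ⟨(gd_univ j _).2 (hc j hj), by simp⟩⟩
      rintro y ⟨b, hb, hb'⟩ hy
      exact hxI (relint_dich hc hs hb hy)
    · rintro ⟨σ, hσ, hx⟩
      exact ⟨HO_sub _ _ _ _ hx, (Finset.mem_filter.1 hσ).2 x hx⟩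
    · rintro x σ hσ τ hτ ⟨b, hb, hb'⟩ ⟨c, hc, hc'⟩
      exact Del_uniq (Finset.mem_filter.1 hσ).1 (Finset.mem_filter.1 hτ).1 b c
        (fun j hj => (gd_univ j _).1 (hb' j hj).1) (fun j hj => (gd_univ j _).1 (hc' j hj).1)
        (by rw [hb, hc])

lemma poly_of_coeff (f : PowerSeries ℤ) (N : ℕ) (h : ∀ n, N < n → PowerSeries.coeff n f = 0) :
    ∃ p : Polynomial ℤ, (p : PowerSeries ℤ) = f ∧ p.natDegree ≤ N := by
  refine ⟨PowerSeries.trunc (N + 1) f, ?_, ?_⟩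
  · ext n
    rw [Polynomial.coeff_coe, PowerSeries.coeff_trunc]
    split_ifs with hn
    · rfl
    · exact (h n (by omega)).symm
  · exact Nat.lt_succ_iff.1 (PowerSeries.natDegree_trunc_lt f N)

lemma natDegree_one_sub (q k : ℕ) : ((1 - Polynomial.X ^ q : Polynomial ℤ) ^ k).natDegree ≤ k * q := by
  refine Polynomial.natDegree_pow_le_of_le k ?_
  refine (Polynomial.natDegree_sub_le _ _).trans ?_
  simp

include hq hu in
lemma core_poly : ∃ h : Polynomial ℤ,
    (h : PowerSeries ℤ) = (1 - PowerSeries.X ^ q) ^ d * gf (latC u \ latI u ξ) ∧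
    h.natDegree ≤ q * d := by
  obtain ⟨D, hD, hs⟩ := core_B hq hu (ξ := ξ)
  have hp : ∀ σ ∈ D, ∃ p : Polynomial ℤ, (p : PowerSeries ℤ) =
      (1 - PowerSeries.X ^ q) ^ d * gf (HO u σ Finset.univ ∅) ∧ p.natDegree ≤ q * d := by
    intro σ hσ
    obtain ⟨hi, hc⟩ := hD σ hσ
    obtain ⟨p, hp, hd⟩ := poly_of_coeff _ (q * σ.card) (box_coeff_zero hu σ Finset.univ)
    refine ⟨(1 - Polynomial.X ^ q) ^ (d - σ.card) * p, ?_, ?_⟩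
    · rw [Polynomial.coe_mul, hp, ← HO_box hq hu _ σ hi subset_rfl, ← mul_assoc]
      congr 1
      have : (((1 - Polynomial.X ^ q) ^ (d - σ.card) : Polynomial ℤ) : PowerSeries ℤ) =
          (1 - PowerSeries.X ^ q) ^ (d - σ.card) := by simp
      rw [this, ← pow_add, Nat.sub_add_cancel hc]
    · refine Polynomial.natDegree_mul_le.trans ?_
      have h1 := natDegree_one_sub q (d - σ.card)
      have h2 : q * d = (d - σ.card) * q + q * σ.card := by
        rw [mul_comm _ q, ← mul_add, Nat.sub_add_cancel hc]
      omega
  choose! p hp using hp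
  refine ⟨∑ σ ∈ D, p σ, ?_, Polynomial.natDegree_sum_le_of_forall_le _ _ fun σ hσ => (hp σ hσ).2⟩
  rw [hs, Finset.mul_sum, ← Polynomial.coeToPowerSeries.ringHom_apply, map_sum]
  refine Finset.sum_congr rfl fun σ hσ => ?_
  rw [Polynomial.coeToPowerSeries.ringHom_apply, (hp σ hσ).1]

include hq hu hg hξ in
lemma core_main : ∃ h : Polynomial ℤ,
    (h : PowerSeries ℤ) = (1 - PowerSeries.X ^ q) ^ d * gf (latC u \ latI u ξ) ∧
    h.natDegree ≤ q * d ∧ ∀ i ≤ q * d, h.coeff i = h.coeff (q * d - i) := by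
  obtain ⟨h, h1, h2⟩ := core_poly hq hu (ξ := ξ)
  refine ⟨h, h1, h2, ?_⟩
  obtain ⟨A, hA1, hA2⟩ := core_T hq hu hg hξ
  have hsub : gf (latC u) = gf (latC u \ latI u ξ) + gf (latI u ξ) := by
    apply gf_union hq hu subset_rfl Set.disjoint_sdiff_left
    rw [Set.sdiff_union_of_subset (latI_sub hξ)]
  have hH : ((h * (1 - Polynomial.X ^ q) : Polynomial ℤ) : PowerSeries ℤ) =
      ∑ σ ∈ TT u, (gf (HO u σ (A σ) σ) - gf (HO u σ (A σ)ᶜ σ)) := by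
    have e1 : ((h * (1 - Polynomial.X ^ q) : Polynomial ℤ) : PowerSeries ℤ) =
        (1 - PowerSeries.X ^ q) ^ (d + 1) * (gf (latC u) - gf (latI u ξ)) := by
      rw [hsub, Polynomial.coe_mul, h1]
      simp only [Polynomial.coe_sub, Polynomial.coe_one, Polynomial.coe_pow, Polynomial.coe_X]
      ring
    rw [e1, hA1, hA2, ← Finset.sum_sub_distrib, Finset.mul_sum]
    refine Finset.sum_congr rfl fun σ hσ => ?_
    have hc := (Finset.mem_filter.1 hσ).2
    rw [mul_sub, ← HO_box hq hu _ σ (T_ind hσ) subset_rfl, ← HO_box hq hu _ σ (T_ind hσ) subset_rfl,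
      hc]
  have hz : ∀ n, q * d + q < n → (h * (1 - Polynomial.X ^ q)).coeff n = 0 := by
    intro n hn
    rw [← Polynomial.coeff_coe, hH, map_sum]
    refine Finset.sum_eq_zero fun σ hσ => ?_
    have hc := (Finset.mem_filter.1 hσ).2
    have hn' : q * σ.card < n := by rw [hc, mul_add, mul_one]; exact hn
    rw [map_sub, box_coeff_zero hu σ _ n hn', box_coeff_zero hu σ _ n hn', sub_zero]
  have hs : ∀ n k, n + k = q * d + q → (h * (1 - Polynomial.X ^ q)).coeff n =
      - (h * (1 - Polynomial.X ^ q)).coeff k := by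
    intro n k hn
    rw [← Polynomial.coeff_coe, ← Polynomial.coeff_coe, hH, map_sum, map_sum,
      ← Finset.sum_neg_distrib]
    refine Finset.sum_congr rfl fun σ hσ => ?_
    have hc := (Finset.mem_filter.1 hσ).2
    have hn' : n + k = q * σ.card := by rw [hc, mul_add, mul_one]; exact hn
    rw [map_sub, map_sub, box_symm hu σ _ n k hn', box_symm hu σ _ n k hn', compl_compl]
    ring
  have hr : Polynomial.reflect (q * d + q) (h * (1 - Polynomial.X ^ q)) =
      - (h * (1 - Polynomial.X ^ q)) := by
    ext n
    rw [Polynomial.coeff_reflect, Polynomial.coeff_neg]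
    by_cases hn : n ≤ q * d + q
    · rw [Polynomial.revAt_le hn]
      exact hs _ _ (by omega)
    · rw [Polynomial.revAt_eq_self_of_lt (by omega), hz n (by omega), neg_zero]
  have hX : Polynomial.reflect q (1 - Polynomial.X ^ q : Polynomial ℤ) = -(1 - Polynomial.X ^ q) := by
    rw [sub_eq_add_neg, Polynomial.reflect_add, Polynomial.reflect_neg]
    have a1 : Polynomial.reflect q (1 : Polynomial ℤ) = Polynomial.X ^ q := by
      simp
    have a2 : Polynomial.reflect q (Polynomial.X ^ q : Polynomial ℤ) = 1 := by
      simp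
    rw [a1, a2]; ring
  have hnd : (1 - Polynomial.X ^ q : Polynomial ℤ).natDegree ≤ q := by
    simpa using natDegree_one_sub q 1
  rw [Polynomial.reflect_mul h _ h2 hnd, hX, mul_neg, neg_inj] at hr
  have hne : (1 - Polynomial.X ^ q : Polynomial ℤ) ≠ 0 := by
    intro h0
    have := congrArg (fun p => Polynomial.coeff p 0) h0
    simp [Polynomial.coeff_X_pow, hq.ne] at this
  have hr' := mul_right_cancel₀ hne hr
  intro i hi
  conv_lhs => rw [← hr']
  rw [Polynomial.coeff_reflect, Polynomial.revAt_le hi]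

end core

section geom
variable {d m q : ℕ} {P : Set (Fin d → ℝ)} {v : Fin m → Fin d → ℤ}

def uu {d m : ℕ} (q : ℕ) (v : Fin m → Fin d → ℤ) (j : Fin m) : LL d := (v j, (q : ℤ))

lemma inCone_snd (hq : 0 < q) {y : EE d} (h : inCone (fun j => emb (uu q v j)) y) :
    0 ≤ y.2 ∧ (y.2 = 0 → y = 0) := by
  have hq' : (0:ℝ) < q := by exact_mod_cast hq
  obtain ⟨c, hc, rfl⟩ := h
  have e : (∑ j, c j • emb (uu q v j)).2 = ∑ j, c j * (q:ℝ) := by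
    simp [Prod.snd_sum, emb_snd, uu]
  rw [e]
  refine ⟨Finset.sum_nonneg fun j _ => mul_nonneg (hc j) hq'.le, fun h => ?_⟩
  have := (Finset.sum_eq_zero_iff_of_nonneg fun j _ => mul_nonneg (hc j) hq'.le).1 h
  refine Finset.sum_eq_zero fun j hj => ?_
  have := this j hj
  have : c j = 0 := by
    rcases mul_eq_zero.1 this with h | h
    · exact h
    · exact absurd h hq'.ne'
  simp [this]

lemma slice_iff (hq : 0 < q)
    (hP : (q:ℝ) • P = convexHull ℝ (Set.range fun j : Fin m => fun i => (v j i : ℝ)))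
    (x : Fin d → ℝ) {t : ℝ} (ht : 0 < t) :
    inCone (fun j => emb (uu q v j)) (x, t) ↔ x ∈ t • P := by
  have hq' : (0:ℝ) < q := by exact_mod_cast hq
  have e : t • P = (t / q) • convexHull ℝ (Set.range fun j : Fin m => fun i => (v j i : ℝ)) := by
    rw [← hP, smul_smul, div_mul_cancel₀ _ hq'.ne']
  rw [e]
  constructor
  · rintro ⟨c, hc, hs⟩
    have h1 : ∑ j, c j • (fun i => (v j i : ℝ)) = x := by
      have := congrArg Prod.fst hs
      rw [Prod.fst_sum] at this
      exact this
    have h2 : ∑ j, c j * (q:ℝ) = t := by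
      have := congrArg Prod.snd hs
      simpa [Prod.snd_sum, emb_snd, uu] using this
    refine ⟨∑ j, (c j * q / t) • (fun i => (v j i : ℝ)), ?_, ?_⟩
    · refine (convex_convexHull ℝ _).sum_mem (fun j _ => ?_) ?_ fun j _ =>
        subset_convexHull ℝ _ ⟨j, rfl⟩
      · have := hc j; positivity
      · rw [← Finset.sum_div, h2, div_self ht.ne']
    · change (t / q) • _ = _
      rw [← h1, Finset.smul_sum]
      refine Finset.sum_congr rfl fun j _ => ?_
      rw [smul_smul]
      congr 1
      field_simp
  · rintro ⟨z, hz, rfl⟩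
    have hsub : convexHull ℝ (Set.range fun j : Fin m => fun i => (v j i : ℝ)) ⊆
        {z | inCone (fun j => emb (uu q v j)) (z, (q:ℝ))} := by
      refine convexHull_min ?_ ?_
      · rintro _ ⟨j, rfl⟩
        have := inCone_sub (w := fun j => emb (uu q v j)) {j} (fun _ => 1) (fun _ _ => zero_le_one)
        simp only [Finset.sum_singleton, one_smul] at this
        exact this
      · intro a ha b hb s r hs hr hsr
        have := (inCone.smul ha hs).add (inCone.smul hb hr)
        have e : s • (a, (q:ℝ)) + r • (b, (q:ℝ)) = (s • a + r • b, (q:ℝ)) := by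
          ext
          · simp
          · simp [← add_mul, hsr]
        rw [e] at this
        exact this
    have := (hsub hz).smul (t := t / q) (by positivity)
    have e : (t / (q:ℝ)) • (z, (q:ℝ)) = ((t / (q:ℝ)) • z, t) := by
      ext
      · simp
      · simp [div_mul_cancel₀ _ hq'.ne']
    rw [e] at this
    exact this

lemma int_iff (hq : 0 < q)
    (hP : (q:ℝ) • P = convexHull ℝ (Set.range fun j : Fin m => fun i => (v j i : ℝ)))
    (x : Fin d → ℝ) {t : ℝ} (ht : 0 < t) :
    (x, t) ∈ interior {y | inCone (fun j => emb (uu q v j)) y} ↔ x ∈ interior (t • P) := by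
  rw [mem_interior_iff_mem_nhds, mem_interior_iff_mem_nhds]
  constructor
  · intro h
    have hc : Continuous fun x' : Fin d → ℝ => (x', t) := by fun_prop
    filter_upwards [hc.continuousAt.preimage_mem_nhds h] with x' hx'
    exact (slice_iff hq hP x' ht).1 hx'
  · intro h
    have hc : ContinuousAt (fun y : EE d => (t / y.2) • y.1) (x, t) := by
      refine ContinuousAt.smul (ContinuousAt.div continuousAt_const continuousAt_snd ht.ne')
        continuousAt_fst
    have hv : (fun y : EE d => (t / y.2) • y.1) (x, t) = x := by simp [div_self ht.ne']
    have h1 := hc.preimage_mem_nhds (t := t • P) (by change _ ∈ 𝓝 ((fun y : EE d => (t / y.2) • y.1) (x, t)); rw [hv]; exact h)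
    have h2 : ∀ᶠ y : EE d in 𝓝 (x, t), 0 < y.2 :=
      continuousAt_snd.eventually (lt_mem_nhds (by exact ht))
    filter_upwards [h1, h2] with y hy hy2
    refine (slice_iff hq hP y.1 hy2).2 ?_
    obtain ⟨z, hz, hz'⟩ := hy
    refine ⟨z, hz, ?_⟩
    change y.2 • z = y.1
    change t • z = (t / y.2) • y.1 at hz'
    have := congrArg (fun a => (y.2 / t) • a) hz'
    simp only [smul_smul] at this
    rwa [div_mul_cancel₀ _ ht.ne', div_mul_div_cancel₀ ht.ne', div_self hy2.ne', one_smul] at this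

lemma int_alg {w : Fin m → EE d} {ξ : EE d} (hξ : ξ ∈ interior {y | inCone w y}) (y : EE d) :
    y ∈ interior {y | inCone w y} ↔ ∃ t : ℝ, 0 < t ∧ inCone w (y - t • ξ) := by
  constructor
  · intro h
    have hc : Continuous fun t : ℝ => y - t • ξ := by fun_prop
    have h1 : ∀ᶠ t in 𝓝[>] (0:ℝ), y - t • ξ ∈ {y | inCone w y} :=
      nhdsWithin_le_nhds (hc.continuousAt.preimage_mem_nhds
        (by simpa using mem_interior_iff_mem_nhds.1 h))
    obtain ⟨t, h1, ht⟩ := (h1.and self_mem_nhdsWithin).exists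
    exact ⟨t, ht, h1⟩
  · rintro ⟨t, ht, h⟩
    rw [mem_interior_iff_mem_nhds] at hξ ⊢
    have hc : Continuous fun z : EE d => t⁻¹ • (z - (y - t • ξ)) := by fun_prop
    filter_upwards [hc.continuousAt.preimage_mem_nhds (x := y)
      (by simpa [smul_smul, inv_mul_cancel₀ ht.ne'] using hξ)] with z hz
    have h2 := h.add (inCone.smul hz ht.le)
    rw [smul_smul, mul_inv_cancel₀ ht.ne', one_smul, add_sub_cancel] at h2
    exact h2

lemma exists_gen {u : Fin m → LL d} (hne : (interior {y | inCone (fun j => emb (u j)) y}).Nonempty) :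
    ∃ ξ ∈ interior {y | inCone (fun j => emb (u j)) y}, Gen u ξ := by
  obtain ⟨x0, hx0⟩ := hne
  have hη : ∃ η : EE d, Gen u η := by
    by_contra hcon
    have : (⋃ σ : {σ : Finset (Fin m) // σ.card ≤ d}, (Wsp u σ.1 : Set (EE d))) = Set.univ := by
      rw [Set.eq_univ_iff_forall]
      intro y
      by_contra hy
      apply hcon
      refine ⟨y, fun σ hσ hm => hy (Set.mem_iUnion.2 ⟨⟨σ, hσ⟩, hm⟩)⟩
    obtain ⟨σ, hσ⟩ := Subspace.exists_eq_top_of_iUnion_eq_univ this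
    exact Wsp_ne_top u σ.1 σ.2 hσ
  obtain ⟨η, hη⟩ := hη
  have h2 : ∀ᶠ ε in 𝓝[>] (0:ℝ), ∀ σ : Finset (Fin m), σ.card ≤ d → x0 + ε • η ∉ Wsp u σ := by
    rw [Filter.eventually_all]
    intro σ
    by_cases h : σ.card ≤ d
    · filter_upwards [avoid (Wsp u σ) η x0 (hη σ h)] with ε hε _ using hε
    · exact Eventually.of_forall fun _ h' => absurd h' h
  have hc : Continuous fun t : ℝ => x0 + t • η := by fun_prop
  have h1 : ∀ᶠ t in 𝓝[>] (0:ℝ), x0 + t • η ∈ interior {y | inCone (fun j => emb (u j)) y} :=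
    nhdsWithin_le_nhds (hc.continuousAt.preimage_mem_nhds
      (by simpa using isOpen_interior.mem_nhds hx0))
  obtain ⟨ε, h1, h2⟩ := (h1.and h2).exists
  exact ⟨_, h1, h2⟩

lemma ehr_eq (hq : 0 < q) (hcl : IsCompact P)
    (hP : (q:ℝ) • P = convexHull ℝ (Set.range fun j : Fin m => fun i => (v j i : ℝ)))
    {ξ : EE d} (hξ : ξ ∈ interior {y | inCone (fun j => emb (uu q v j)) y}) (hg : Gen (uu q v) ξ) :
    ehrBdSeries P = gf (latC (uu q v) \ latI (uu q v) ξ) := by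
  ext n
  simp only [ehrBdSeries, gf, PowerSeries.coeff_mk]
  split_ifs with hn
  · subst hn
    have : slc (latC (uu q v) \ latI (uu q v) ξ) 0 = {0} := by
      ext x
      simp only [Set.mem_singleton_iff]
      constructor
      · rintro ⟨h, -⟩
        have := (inCone_snd hq h).2 (by simp [emb_snd])
        ext i
        have := congrFun (congrArg Prod.fst this) i
        rw [emb_fst] at this
        have this' : ((x i : ℤ) : ℝ) = 0 := this
        exact_mod_cast this'
      · rintro rfl
        have h0 : emb (((0 : Fin d → ℤ), ((0:ℕ):ℤ)) : LL d) = 0 := by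
          rw [Nat.cast_zero]; exact map_zero emb
        refine ⟨?_, ?_⟩
        · change inCone _ _
          rw [h0]
          exact ⟨0, by simp, by simp⟩
        · rintro ⟨t, ht, h⟩
          rw [h0] at h
          have h1 := (inCone_snd hq h).1
          have hξC : inCone (fun j => emb (uu q v j)) ξ := (interior_subset hξ : ξ ∈ {y | inCone (fun j => emb (uu q v j)) y})
          have h2 := inCone_snd hq hξC
          have h3 : ξ.2 ≠ 0 := fun h3 => hg ∅ (by simp) (by rw [h2.2 h3]; exact Submodule.zero_mem _)
          have h4 : 0 < ξ.2 := lt_of_le_of_ne h2.1 h3.symm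
          simp only [Prod.snd_sub, Prod.snd_zero, Prod.smul_snd, smul_eq_mul] at h1
          nlinarith [mul_pos ht h4]
    rw [this]; simp
  · have hn' : (0:ℝ) < n := by exact_mod_cast Nat.pos_of_ne_zero hn
    congr 1
    rw [latCount]
    have hinj : Function.Injective (fun (z : Fin d → ℤ) (i : Fin d) => (z i : ℝ)) := by
      intro a b h
      ext i
      have h' : ((a i : ℤ) : ℝ) = (b i : ℝ) := congrFun h i
      exact_mod_cast h'
    rw [← Set.ncard_image_of_injective _ hinj]
    congr 1
    have hcl' : IsClosed ((n:ℝ) • P) := (hcl.smul (n:ℝ)).isClosed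
    have key : ∀ z : Fin d → ℤ, z ∈ slc (latC (uu q v) \ latI (uu q v) ξ) n ↔
        (fun i => (z i : ℝ)) ∈ frontier ((n:ℝ) • P) := by
      intro z
      have e : emb ((z, (n:ℤ)) : LL d) = ((fun i => (z i : ℝ)), (n:ℝ)) := by
        ext <;> simp [emb_fst, emb_snd]
      rw [hcl'.frontier_eq, Set.mem_sdiff, ← slice_iff hq hP _ hn', ← int_iff hq hP _ hn',
        int_alg hξ, ← e]
      rfl
    ext x
    constructor
    · rintro ⟨hx, hl⟩
      choose z hz using hl
      have : x = fun i => (z i : ℝ) := funext hz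
      subst this
      exact ⟨z, (key z).2 hx, rfl⟩
    · rintro ⟨z, hz, rfl⟩
      exact ⟨(key z).1 hz, fun i => ⟨z i, rfl⟩⟩

end geom

theorem boundary_hstar_palindromic {d q : ℕ} (P : Set (Fin d → ℝ))
    (hrat : IsRationalPolytope P) (hfull : IsFullDim P) (hq : IsDenominator P q) :
    ∃ hB : Polynomial ℤ,
      (hB : PowerSeries ℤ) = (1 - PowerSeries.X ^ q) ^ d * ehrBdSeries P ∧
      hB.natDegree = q * d ∧
      ∀ i ≤ q * d, hB.coeff i = hB.coeff (q * d - i) := by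
  obtain ⟨hq0, ⟨V, hV, hPV⟩, -⟩ := hq
  have hcpt : IsCompact P := by
    obtain ⟨U, -, rfl⟩ := hrat
    exact U.finite_toSet.isCompact_convexHull ℝ
  choose! a ha using hV
  let v : Fin V.card → Fin d → ℤ := fun j => a (V.equivFin.symm j).1
  have hP : (q:ℝ) • P = convexHull ℝ (Set.range fun j : Fin V.card => fun i => (v j i : ℝ)) := by
    rw [hPV]
    congr 1
    ext x
    constructor
    · intro hx
      refine ⟨V.equivFin ⟨x, hx⟩, ?_⟩
      ext i
      simp only [v, Equiv.symm_apply_apply]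
      exact (ha x hx i).symm
    · rintro ⟨j, rfl⟩
      have : (fun i => (v j i : ℝ)) = (V.equivFin.symm j).1 := by
        ext i
        exact (ha _ (V.equivFin.symm j).2 i).symm
      change (fun i => (v j i : ℝ)) ∈ _
      rw [this]
      exact (V.equivFin.symm j).2
  have hne : (interior {y | inCone (fun j => emb (uu q v j)) y}).Nonempty := by
    obtain ⟨x, hx⟩ := hfull
    exact ⟨(x, 1), (int_iff hq0 hP x one_pos).2 (by rwa [one_smul])⟩
  obtain ⟨ξ, hξ, hg⟩ := exists_gen hne
  have he := ehr_eq hq0 hcpt hP hξ hg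
  have hξC : inCone (fun j => emb (uu q v j)) ξ :=
    (interior_subset hξ : ξ ∈ {y | inCone (fun j => emb (uu q v j)) y})
  obtain ⟨h, h1, h2, h3⟩ := core_main (q := q) hq0 (u := uu q v) (fun _ => rfl) hg hξC
  rw [← he] at h1
  refine ⟨h, h1, ?_, h3⟩
  have hc0 : h.coeff 0 = 1 := by
    rw [← Polynomial.coeff_coe, h1, PowerSeries.coeff_zero_eq_constantCoeff_apply]
    have : PowerSeries.constantCoeff (ehrBdSeries P) = 1 := by
      rw [← PowerSeries.coeff_zero_eq_constantCoeff_apply]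
      simp [ehrBdSeries]
    simp [this, hq0.ne']
  have hc1 : h.coeff (q * d) = 1 := by
    have := h3 0 (Nat.zero_le _)
    rw [hc0, Nat.sub_zero] at this
    exact this.symm
  exact le_antisymm h2 (Polynomial.le_natDegree_of_ne_zero (by rw [hc1]; exact one_ne_zero))
end

section
/- Let P ⊂ ℝ^d be a full-dimensional rational polytope with denominator q. Then the polynomial 1 + z + ⋯ + z^{q−1} divides h*_P(z) in ℤ[z]. -/
open Pointwise

open Filter Topology in
theorem aux_choose (d k : ℕ) :
    Tendsto (fun m : ℕ => ((Nat.choose (d + (m - k)) d : ℕ) : ℝ) / (m : ℝ) ^ d) atTop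
      (𝓝 (1 / (d.factorial : ℝ))) := by
  have hn : Tendsto (fun m : ℕ => d + (m - k)) atTop atTop :=
    tendsto_atTop_mono (fun m => by omega) (tendsto_sub_atTop_nat k)
  have h1 := (isEquivalent_choose d).comp_tendsto hn
  have h2 : Tendsto (fun m : ℕ => ((d + (m - k) : ℕ) : ℝ) / (m : ℝ)) atTop (𝓝 1) := by
    have h3 : Tendsto (fun m : ℕ => 1 + ((d : ℝ) - k) / (m : ℝ)) atTop (𝓝 (1 + 0)) :=
      tendsto_const_nhds.add (tendsto_const_div_atTop_nhds_zero_nat _)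
    rw [add_zero] at h3
    refine h3.congr' ?_
    filter_upwards [eventually_ge_atTop (k + 1)] with m hm
    have : (m : ℝ) ≠ 0 := by
      have : 0 < m := by omega
      positivity
    rw [Nat.cast_add, Nat.cast_sub (by omega)]
    field_simp
    ring
  have h4 := (h2.pow d).div_const (d.factorial : ℝ)
  rw [one_pow] at h4
  have h5 : (fun m : ℕ => (((d + (m - k) : ℕ) : ℝ) / (m : ℝ)) ^ d / (d.factorial : ℝ)) =
      fun m : ℕ => (((d + (m - k) : ℕ) : ℝ) ^ d / (d.factorial : ℝ)) / (m : ℝ) ^ d := by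
    funext m
    rw [div_pow, div_right_comm]
  rw [h5] at h4
  have h6 := h1.div (Asymptotics.IsEquivalent.refl (u := fun m : ℕ => (m : ℝ) ^ d))
  exact h6.symm.tendsto_nhds h4

noncomputable def auxC (d q : ℕ) (hq : q ≠ 0) : PowerSeries ℤ :=
  PowerSeries.expand q hq (PowerSeries.mk fun n => ((Nat.choose (d + n) d : ℕ) : ℤ))

theorem auxC_mul (d q : ℕ) (hq : q ≠ 0) :
    auxC d q hq * (1 - PowerSeries.X ^ q) ^ (d + 1) = 1 := by
  have := congrArg (PowerSeries.expand q hq) (PowerSeries.mk_add_choose_mul_one_sub_pow_eq_one ℤ d)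
  simpa [auxC] using this

open Filter Topology in
theorem auxC_lim (d q : ℕ) (hq : q ≠ 0) (r i : ℕ) (hr : r < q) :
    Tendsto (fun m : ℕ => ((PowerSeries.coeff (q * m + r - i) (auxC d q hq) : ℤ) : ℝ)
      / (m : ℝ) ^ d) atTop (𝓝 (if i % q = r then 1 / (d.factorial : ℝ) else 0)) := by
  split_ifs with h
  · refine (aux_choose d (i / q)).congr' ?_
    filter_upwards [eventually_ge_atTop (i / q)] with m hm
    have : q * m + r - i = q * (m - i / q) := by
      have := Nat.div_add_mod i q
      rw [Nat.mul_sub]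
      omega
    rw [this, auxC, PowerSeries.coeff_expand_mul, PowerSeries.coeff_mk]
    simp
  · refine tendsto_const_nhds.congr' ?_
    filter_upwards [eventually_ge_atTop i] with m hm
    rw [auxC, PowerSeries.coeff_expand_of_not_dvd]
    · simp
    · intro hd
      apply h
      have hle : i ≤ q * m + r :=
        hm.trans ((Nat.le_mul_of_pos_left m (by omega)).trans (Nat.le_add_right _ _))
      have := (Nat.modEq_iff_dvd' hle).2 hd
      have h2 : i % q = (q * m + r) % q := this
      rwa [Nat.mul_add_mod, Nat.mod_eq_of_lt hr] at h2

open Filter Topology in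
theorem aux_ser_lim (d q : ℕ) (hq : q ≠ 0) (p : Polynomial ℤ) (E : PowerSeries ℤ)
    (h : (p : PowerSeries ℤ) = (1 - PowerSeries.X ^ q) ^ (d + 1) * E) (r : ℕ) (hr : r < q) :
    Tendsto (fun m : ℕ => ((PowerSeries.coeff (q * m + r) E : ℤ) : ℝ) / (m : ℝ) ^ d) atTop
      (𝓝 (((∑ i ∈ Finset.range (p.natDegree + 1), if i % q = r then p.coeff i else 0 : ℤ) : ℝ)
        / (d.factorial : ℝ))) := by
  have hE : E = (p : PowerSeries ℤ) * auxC d q hq := by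
    rw [h, mul_right_comm, mul_comm _ (auxC d q hq), auxC_mul, one_mul]
  have hlim := tendsto_finsetSum (Finset.range (p.natDegree + 1)) (fun i _ =>
    (auxC_lim d q hq r i hr).const_mul (p.coeff i : ℝ))
  have e1 : (∑ i ∈ Finset.range (p.natDegree + 1),
      (p.coeff i : ℝ) * (if i % q = r then 1 / (d.factorial : ℝ) else 0)) =
      ((∑ i ∈ Finset.range (p.natDegree + 1), if i % q = r then p.coeff i else 0 : ℤ) : ℝ)
        / (d.factorial : ℝ) := by
    push_cast
    rw [Finset.sum_div]
    refine Finset.sum_congr rfl fun i _ => ?_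
    split_ifs <;> simp [div_eq_mul_inv]
  rw [e1] at hlim
  refine hlim.congr' ?_
  filter_upwards [eventually_ge_atTop p.natDegree] with m hm
  have hle : p.natDegree ≤ q * m + r :=
    hm.trans ((Nat.le_mul_of_pos_left m (by omega)).trans (Nat.le_add_right _ _))
  rw [hE, PowerSeries.coeff_mul, Finset.Nat.sum_antidiagonal_eq_sum_range_succ_mk]
  have : ∑ k ∈ Finset.range (q * m + r).succ, (PowerSeries.coeff k (p : PowerSeries ℤ)) *
      (PowerSeries.coeff (q * m + r - k) (auxC d q hq)) =
      ∑ k ∈ Finset.range (p.natDegree + 1), p.coeff k *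
        (PowerSeries.coeff (q * m + r - k) (auxC d q hq)) := by
    symm
    simp only [Polynomial.coeff_coe]
    refine Finset.sum_subset ?_ ?_
    · intro x hx
      simp only [Finset.mem_range] at *
      omega
    · intro x _ hx
      simp only [Finset.mem_range] at hx
      rw [Polynomial.coeff_eq_zero_of_natDegree_lt (by omega), zero_mul]
  simp only [] at this ⊢
  rw [this]
  push_cast
  rw [Finset.sum_div]
  refine Finset.sum_congr rfl fun i _ => ?_
  ring

open Filter Topology MeasureTheory in
theorem aux_latCount_lim {d : ℕ} (P : Set (Fin d → ℝ)) (hb : Bornology.IsBounded P)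
    (hc : Convex ℝ P) (hm : MeasurableSet P) :
    Tendsto (fun n : ℕ => (latCount ((n : ℝ) • P) : ℝ) / (n : ℝ) ^ d) atTop
      (𝓝 (volume.real P)) := by
  have h := tendsto_card_div_pow_atTop_volume P hb hm (hc.addHaar_frontier volume)
  rw [Fintype.card_fin] at h
  refine h.congr' ?_
  filter_upwards [eventually_gt_atTop 0] with n hn
  have hn' : (n : ℝ) ≠ 0 := by positivity
  congr 2
  rw [latCount, Nat.card_coe_set_eq]
  have : {x ∈ (n : ℝ) • P | IsLatticePt x} = (fun x => (n : ℝ) • x) '' (P ∩ (n : ℝ)⁻¹ •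
      (Submodule.span ℤ (Set.range (Pi.basisFun ℝ (Fin d))) : Set (Fin d → ℝ))) := by
    rw [Set.image_smul, Set.smul_set_inter₀ hn', smul_inv_smul₀ hn']
    ext x
    simp only [Set.mem_setOf_eq, Set.mem_inter_iff, SetLike.mem_coe]
    refine and_congr_right fun _ => ?_
    rw [(Pi.basisFun ℝ (Fin d)).mem_span_iff_repr_mem ℤ]
    simp [IsLatticePt, eq_comm]
  rw [this, Set.ncard_image_of_injective]
  exact smul_right_injective _ hn'

theorem aux_dvd (q : ℕ) (hq : 0 < q) (p : Polynomial ℤ) (c : ℤ)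
    (h : ∀ r < q, (∑ i ∈ Finset.range (p.natDegree + 1), if i % q = r then p.coeff i else 0) = c) :
    (∑ i ∈ Finset.range q, (Polynomial.X : Polynomial ℤ) ^ i) ∣ p := by
  have hg : (∑ i ∈ Finset.range q, (Polynomial.X : Polynomial ℤ) ^ i) ∣ Polynomial.X ^ q - 1 :=
    ⟨Polynomial.X - 1, (geom_sum_mul _ _).symm⟩
  have hi : ∀ i : ℕ, (∑ i ∈ Finset.range q, (Polynomial.X : Polynomial ℤ) ^ i) ∣
      Polynomial.X ^ i - Polynomial.X ^ (i % q) := by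
    intro i
    refine hg.trans ?_
    have e : (Polynomial.X : Polynomial ℤ) ^ i - Polynomial.X ^ (i % q) =
        Polynomial.X ^ (i % q) * ((Polynomial.X ^ q) ^ (i / q) - 1 ^ (i / q)) := by
      conv_lhs => rw [← Nat.mod_add_div i q]
      rw [Nat.add_mul_mod_self_left, Nat.mod_mod, pow_add, pow_mul]
      ring
    rw [e]
    exact (sub_dvd_pow_sub_pow _ _ _).mul_left _
  have h1 : (∑ i ∈ Finset.range (p.natDegree + 1),
      Polynomial.C (p.coeff i) * (Polynomial.X : Polynomial ℤ) ^ (i % q)) =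
      Polynomial.C c * ∑ i ∈ Finset.range q, (Polynomial.X : Polynomial ℤ) ^ i := by
    have : ∀ i, Polynomial.C (p.coeff i) * (Polynomial.X : Polynomial ℤ) ^ (i % q) =
        ∑ r ∈ Finset.range q,
          Polynomial.C (if i % q = r then p.coeff i else 0) * Polynomial.X ^ r := by
      intro i
      rw [Finset.sum_eq_single (i % q)]
      · simp
      · intro b _ hb
        rw [if_neg (Ne.symm hb)]
        simp
      · intro hh
        exact absurd (Finset.mem_range.2 (Nat.mod_lt _ hq)) hh
    simp_rw [this]
    rw [Finset.sum_comm, Finset.mul_sum]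
    refine Finset.sum_congr rfl fun r hr => ?_
    rw [← Finset.sum_mul, ← map_sum, h r (Finset.mem_range.1 hr)]
  have h2 : p = (∑ i ∈ Finset.range (p.natDegree + 1),
      Polynomial.C (p.coeff i) * (Polynomial.X ^ i - (Polynomial.X : Polynomial ℤ) ^ (i % q))) +
      Polynomial.C c * ∑ i ∈ Finset.range q, (Polynomial.X : Polynomial ℤ) ^ i := by
    rw [← h1, ← Finset.sum_add_distrib]
    conv_lhs => rw [p.as_sum_range_C_mul_X_pow]
    refine Finset.sum_congr rfl fun i _ => ?_
    ring
  rw [h2]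
  exact dvd_add (Finset.dvd_sum fun i _ => (hi i).mul_left _) (dvd_mul_left _ _)

/-- For a full-dimensional rational polytope `P ⊆ ℝ^d` with denominator
`q`, the polynomial `1 + z + ⋯ + z^{q−1}` divides `h*_P(z)` in `ℤ[z]`. -/
theorem geom_divides_hstar {d q : ℕ} (P : Set (Fin d → ℝ))
    (hrat : IsRationalPolytope P) (hfull : IsFullDim P) (hq : IsDenominator P q)
    (hP : Polynomial ℤ) (hPdeg : hP.natDegree < q * (d + 1))
    (hPeq : (hP : PowerSeries ℤ) = (1 - PowerSeries.X ^ q) ^ (d + 1) * ehrSeries P) :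
    (∑ i ∈ Finset.range q, (Polynomial.X : Polynomial ℤ) ^ i) ∣ hP := by
  obtain ⟨V, -, hV⟩ := hrat
  have hq0 : 0 < q := hq.1
  have hcomp : IsCompact P := by
    rw [hV]
    exact V.finite_toSet.isCompact_convexHull (𝕜 := ℝ)
  have hconv : Convex ℝ P := by
    rw [hV]
    exact convex_convexHull ℝ _
  have hL := aux_latCount_lim P hcomp.isBounded hconv hcomp.isClosed.measurableSet
  have key : ∀ r < q, ((∑ i ∈ Finset.range (hP.natDegree + 1),
      if i % q = r then hP.coeff i else 0 : ℤ) : ℝ) / (d.factorial : ℝ) =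
      MeasureTheory.volume.real P * (q : ℝ) ^ d := by
    intro r hr
    refine tendsto_nhds_unique (aux_ser_lim d q hq0.ne' hP (ehrSeries P) hPeq r hr) ?_
    have hn : Filter.Tendsto (fun m : ℕ => q * m + r) Filter.atTop Filter.atTop :=
      Filter.tendsto_atTop_mono
        (fun m => (Nat.le_mul_of_pos_left m hq0).trans (Nat.le_add_right _ _)) Filter.tendsto_id
    have h2 : Filter.Tendsto (fun m : ℕ => ((q * m + r : ℕ) : ℝ) / (m : ℝ)) Filter.atTop
        (nhds (q : ℝ)) := by
      have h3 : Filter.Tendsto (fun m : ℕ => (q : ℝ) + (r : ℝ) / (m : ℝ)) Filter.atTop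
          (nhds ((q : ℝ) + 0)) :=
        tendsto_const_nhds.add (tendsto_const_div_atTop_nhds_zero_nat _)
      rw [add_zero] at h3
      refine h3.congr' ?_
      filter_upwards [Filter.eventually_gt_atTop 0] with m hm
      push_cast
      field_simp
    refine ((hL.comp hn).mul (h2.pow d)).congr' ?_
    filter_upwards [Filter.eventually_gt_atTop 0] with m hm
    have hpos : 0 < q * m + r := by positivity
    have hne : (((q * m + r : ℕ) : ℝ)) ≠ 0 := by positivity
    simp only [ehrSeries, PowerSeries.coeff_mk, Function.comp_apply, if_neg hpos.ne',
      Int.cast_natCast]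
    rw [div_pow, div_mul_div_cancel₀ (pow_ne_zero _ hne)]
  refine aux_dvd q hq0 hP (∑ i ∈ Finset.range (hP.natDegree + 1),
      if i % q = 0 then hP.coeff i else 0) fun r hr => ?_
  have h := (key r hr).trans (key 0 hq0).symm
  rw [div_left_inj' (by positivity)] at h
  exact_mod_cast h
end
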